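/- Let Ω ⊂ ℝ^d be a nonempty bounded domain with smooth boundary. For every multi-index β there is a constant C such that for every u ∈ C^∞(ℝ_+×ℝ³×Ω̄) satisfying either u|_{y∈∂Ω}=0 or ∂_ν u|_{y∈∂Ω}=0, and every (t,x,y): |∂_y^β u(t,x,y)| ≤ C Σ_{|α|≤|β|+(d+4)/2} ‖∂_{t,x}^α u(t,x,·)‖_{L²(Ω)} + C Σ_{|α|≤|β|+d/2} ‖∂_{t,x,y}^α □u(t,x,·)‖_{L²(Ω)}. -/

import Mathlib

open MeasureTheory

noncomputable section

/-- The partial derivative in the `i`-th coordinate direction on `ℝⁿ`. -/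
def pd {n : ℕ} (i : Fin n) (u : (Fin n → ℝ) → ℝ) : (Fin n → ℝ) → ℝ :=
  fun z => fderiv ℝ u z (Pi.single i 1)

/-- Iterated application of a family of first-order operators along a list of indices. -/
def opIter {α γ : Type*} (F : α → γ → γ) : List α → γ → γ
  | [] => id
  | i :: L => fun u => F i (opIter F L u)

/-- A nonempty bounded domain `Ω ⊂ ℝ^d` with smooth boundary, described by a smooth global
defining function: `Ω = {ρ < 0}`, `∂Ω = {ρ = 0}` and `∇ρ ≠ 0` on `∂Ω` (so `∇ρ` points in the
outward normal direction along the boundary). -/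
structure SmoothDomain (d : ℕ) where
  carrier : Set (Fin d → ℝ)
  isConnected : IsConnected carrier
  isOpen : IsOpen carrier
  isBounded : Bornology.IsBounded carrier
  defFun : (Fin d → ℝ) → ℝ
  defFun_smooth : ContDiff ℝ (⊤ : ℕ∞) defFun
  carrier_eq : carrier = {y | defFun y < 0}
  frontier_eq : frontier carrier = {y | defFun y = 0}
  grad_ne : ∀ y ∈ frontier carrier, fderiv ℝ defFun y ≠ 0

/-- The normal derivative `∂_ν h` on `∂Ω` (computed against the outward normal direction
`∇ρ`; it vanishes iff the genuine normal derivative does). -/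
def SmoothDomain.nder {d : ℕ} (D : SmoothDomain d) (h : (Fin d → ℝ) → ℝ)
    (y : Fin d → ℝ) : ℝ :=
  ∑ i : Fin d, fderiv ℝ D.defFun y (Pi.single i 1) * fderiv ℝ h y (Pi.single i 1)

/-- Partial derivative in the `i`-th `(t,x)` direction of a function on `(ℝ×ℝ³) × ℝ^d`
(coordinates of the first factor: `0 = t`, `1,2,3 = x`). -/
def pdtx {d : ℕ} (i : Fin 4) (u : (Fin 4 → ℝ) → (Fin d → ℝ) → ℝ) :
    (Fin 4 → ℝ) → (Fin d → ℝ) → ℝ :=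
  fun z y => fderiv ℝ (fun z' => u z' y) z (Pi.single i 1)

/-- Partial derivative in the `j`-th `y` direction of a function on `(ℝ×ℝ³) × ℝ^d`. -/
def pdy {d : ℕ} (j : Fin d) (u : (Fin 4 → ℝ) → (Fin d → ℝ) → ℝ) :
    (Fin 4 → ℝ) → (Fin d → ℝ) → ℝ :=
  fun z y => fderiv ℝ (fun y' => u z y') y (Pi.single j 1)

/-- A partial derivative in any of the `t,x,y` directions. -/
def pdmix {d : ℕ} : Fin 4 ⊕ Fin d →
    ((Fin 4 → ℝ) → (Fin d → ℝ) → ℝ) → ((Fin 4 → ℝ) → (Fin d → ℝ) → ℝ)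
  | Sum.inl i => pdtx i
  | Sum.inr j => pdy j

/-- The d'Alembertian `□ = ∂_t² - Δ_{ℝ³} - Δ_Ω` on the waveguide `ℝ×ℝ³×ℝ^d`. -/
def wBox {d : ℕ} (u : (Fin 4 → ℝ) → (Fin d → ℝ) → ℝ) :
    (Fin 4 → ℝ) → (Fin d → ℝ) → ℝ :=
  fun z y => pdtx 0 (pdtx 0 u) z y - pdtx 1 (pdtx 1 u) z y - pdtx 2 (pdtx 2 u) z y -
    pdtx 3 (pdtx 3 u) z y - ∑ j : Fin d, pdy j (pdy j u) z y

/-- Smoothness of a function of `((t,x),y)`, jointly in all variables. -/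
def SmoothC {d : ℕ} (u : (Fin 4 → ℝ) → (Fin d → ℝ) → ℝ) : Prop :=
  ContDiff ℝ (⊤ : ℕ∞) (fun p : (Fin 4 → ℝ) × (Fin d → ℝ) => u p.1 p.2)

/-- The Dirichlet boundary condition `u|_{y ∈ ∂Ω} = 0`. -/
def DirichletBC {d : ℕ} (D : SmoothDomain d) (u : (Fin 4 → ℝ) → (Fin d → ℝ) → ℝ) : Prop :=
  ∀ z : Fin 4 → ℝ, ∀ y ∈ frontier D.carrier, u z y = 0

/-- The Neumann boundary condition `∂_ν u|_{y ∈ ∂Ω} = 0`. -/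
def NeumannBC {d : ℕ} (D : SmoothDomain d) (u : (Fin 4 → ℝ) → (Fin d → ℝ) → ℝ) : Prop :=
  ∀ z : Fin 4 → ℝ, ∀ y ∈ frontier D.carrier, D.nder (u z) y = 0

/-- The `L²(Ω)` norm of `u(t,x,·)` at fixed `(t,x)`. -/
def L2y {d : ℕ} (D : SmoothDomain d) (u : (Fin 4 → ℝ) → (Fin d → ℝ) → ℝ)
    (z : Fin 4 → ℝ) : ℝ :=
  Real.sqrt (∫ y in D.carrier, (u z y)^2)

/-- The algebra of smooth real functions on a normed space. -/
def smoothSubalgebra (E : Type*) [NormedAddCommGroup E] [NormedSpace ℝ E] :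
    Subalgebra ℝ (E → ℝ) where
  carrier := {f | ContDiff ℝ (⊤ : ℕ∞) f}
  mul_mem' {f g} hf hg := by
    change ContDiff ℝ (⊤ : ℕ∞) f at hf
    exact hf.mul hg
  add_mem' {f g} hf hg := by
    change ContDiff ℝ (⊤ : ℕ∞) f at hf
    exact hf.add hg
  algebraMap_mem' c := by
    change ContDiff ℝ (⊤ : ℕ∞) (fun _ : E => c)
    exact contDiff_const

/-- Smooth real functions on a normed space. -/
abbrev SmoothFun (E : Type*) [NormedAddCommGroup E] [NormedSpace ℝ E] : Type _ :=
  smoothSubalgebra E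

namespace SmoothFun

variable {E : Type*} [NormedAddCommGroup E] [NormedSpace ℝ E]

theorem contDiff (f : SmoothFun E) : ContDiff ℝ (⊤ : ℕ∞) (f : E → ℝ) := f.2

theorem continuous (f : SmoothFun E) : Continuous (f : E → ℝ) := f.contDiff.continuous

theorem differentiable (f : SmoothFun E) : Differentiable ℝ (f : E → ℝ) :=
  f.contDiff.differentiable (by simp)

theorem continuous_fderiv (f : SmoothFun E) : Continuous (fderiv ℝ (f : E → ℝ)) :=
  f.contDiff.continuous_fderiv (by simp)

/-- The derivative in the direction `a`, as a derivation of the algebra of smooth functions. -/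
def dir (a : E) : Derivation ℝ (SmoothFun E) (SmoothFun E) :=
  Derivation.mk'
    { toFun := fun f => ⟨fun x => fderiv ℝ (f : E → ℝ) x a,
        (f.contDiff.fderiv_right (m := (⊤ : ℕ∞)) (by simp)).clm_apply contDiff_const⟩
      map_add' := fun f g => by
        ext x
        simp [fderiv_add (f.differentiable x) (g.differentiable x)]
      map_smul' := fun c f => by
        ext x
        simp [fderiv_const_smul (f.differentiable x)] }
    fun f g => by
      ext x
      simp [fderiv_mul (f.differentiable x) (g.differentiable x)]

@[simp] theorem dir_apply (a : E) (f : SmoothFun E) (x : E) :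
    (dir a f : E → ℝ) x = fderiv ℝ (f : E → ℝ) x a := rfl

theorem dir_mul (a : E) (f g : SmoothFun E) : dir a (f * g) = f * dir a g + g * dir a f := by
  simp [Derivation.leibniz]

theorem dir_comm (a b : E) (f : SmoothFun E) : dir a (dir b f) = dir b (dir a f) := by
  have key : ∀ (p q : E) (x : E), (dir p (dir q f) : E → ℝ) x
      = fderiv ℝ (fderiv ℝ (f : E → ℝ)) x p q := by
    intro p q x
    have h : DifferentiableAt ℝ (fderiv ℝ (f : E → ℝ)) x :=
      ((f.contDiff.fderiv_right (m := (⊤ : ℕ∞)) (by simp)).differentiable (by simp)) x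
    rw [dir_apply]
    change fderiv ℝ (fun y => fderiv ℝ (f : E → ℝ) y q) x p = _
    rw [fderiv_clm_apply h (differentiableAt_const q)]
    simp
  ext x
  rw [key, key]
  exact ((f.contDiff.contDiffAt).isSymmSndFDerivAt
    (by simpa using WithTop.coe_le_coe.2 (le_top (a := (2 : ℕ∞))))).eq a b

end SmoothFun

theorem exists_bound_deriv_smoothTransition : ∃ B : ℝ, 0 ≤ B ∧
    (∀ t, |deriv Real.smoothTransition t| ≤ B) ∧
    (∀ t < 0, deriv Real.smoothTransition t = 0) ∧
    (∀ t, 1 < t → deriv Real.smoothTransition t = 0) := by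
  have h0 : ∀ t < 0, deriv Real.smoothTransition t = 0 := by
    intro t ht
    have : Real.smoothTransition =ᶠ[nhds t] fun _ => 0 := by
      filter_upwards [gt_mem_nhds ht] with s hs using Real.smoothTransition.zero_of_nonpos hs.le
    rw [this.deriv_eq]; simp
  have h1 : ∀ t, 1 < t → deriv Real.smoothTransition t = 0 := by
    intro t ht
    have : Real.smoothTransition =ᶠ[nhds t] fun _ => 1 := by
      filter_upwards [lt_mem_nhds ht] with s hs using Real.smoothTransition.one_of_one_le hs.le
    rw [this.deriv_eq]; simp
  have hc : Continuous (deriv Real.smoothTransition) :=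
    (Real.smoothTransition.contDiff (n := 1)).continuous_deriv (by simp)
  obtain ⟨B, hB⟩ := (isCompact_Icc (a := (0 : ℝ)) (b := 1)).exists_bound_of_continuousOn
    hc.continuousOn
  refine ⟨max B 0, le_max_right _ _, fun t => ?_, h0, h1⟩
  by_cases ht : t ∈ Set.Icc (0 : ℝ) 1
  · exact (hB t ht).trans (le_max_left _ _)
  · have : deriv Real.smoothTransition t = 0 := by
      by_cases h : t < 0
      · exact h0 t h
      · exact h1 t (by by_contra h'; exact ht ⟨not_lt.1 h, not_lt.1 h'⟩)
    simp [this]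

namespace SmoothDomain

variable {d : ℕ} (D : SmoothDomain d)

/-- The defining function as a smooth function. -/
def rho : SmoothFun (Fin d → ℝ) := ⟨D.defFun, D.defFun_smooth⟩

theorem mem_carrier_iff {y : Fin d → ℝ} : y ∈ D.carrier ↔ (D.rho : _ → ℝ) y < 0 := by
  rw [D.carrier_eq]; rfl

theorem mem_frontier_iff {y : Fin d → ℝ} : y ∈ frontier D.carrier ↔ (D.rho : _ → ℝ) y = 0 := by
  rw [D.frontier_eq]; rfl

theorem rho_nonpos {y : Fin d → ℝ} (hy : y ∈ closure D.carrier) : (D.rho : _ → ℝ) y ≤ 0 := by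
  rw [closure_eq_self_union_frontier] at hy
  rcases hy with hy | hy
  · exact (D.mem_carrier_iff.1 hy).le
  · exact (D.mem_frontier_iff.1 hy).le

theorem isCompact_closure : IsCompact (closure D.carrier) :=
  D.isBounded.isCompact_closure

theorem measurableSet : MeasurableSet D.carrier := D.isOpen.measurableSet

theorem fderiv_rho_ne {y : Fin d → ℝ} (hy : y ∈ frontier D.carrier) :
    fderiv ℝ (D.rho : _ → ℝ) y ≠ 0 := D.grad_ne y hy

theorem integrableOn {f : (Fin d → ℝ) → ℝ} (hf : Continuous f) :
    IntegrableOn f D.carrier :=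
  (hf.continuousOn.integrableOn_compact D.isCompact_closure).mono_set subset_closure

/-- The function vanishes on the boundary. -/
def VanishOn (f : SmoothFun (Fin d → ℝ)) : Prop := ∀ y ∈ frontier D.carrier, (f : _ → ℝ) y = 0

theorem exists_fderiv_eq_smul {f : SmoothFun (Fin d → ℝ)} (hf : D.VanishOn f) {y : Fin d → ℝ}
    (hy : y ∈ frontier D.carrier) :
    ∃ c : ℝ, fderiv ℝ (f : _ → ℝ) y = c • fderiv ℝ (D.rho : _ → ℝ) y := by
  have hext : IsLocalExtrOn (f : _ → ℝ) {x | (D.rho : _ → ℝ) x = (D.rho : _ → ℝ) y} y := by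
    left
    filter_upwards [self_mem_nhdsWithin] with x hx
    rw [D.mem_frontier_iff.1 hy] at hx
    rw [hf x (D.mem_frontier_iff.2 hx), hf y hy]
  obtain ⟨a, b, hab, h⟩ := hext.exists_multipliers_of_hasStrictFDerivAt_1d
    (D.rho.contDiff.contDiffAt.hasStrictFDerivAt (by simp))
    (f.contDiff.contDiffAt.hasStrictFDerivAt (by simp))
  have hb : b ≠ 0 := by
    rintro rfl
    have ha : a ≠ 0 := by
      rintro rfl
      exact hab rfl
    simp only [zero_smul, add_zero, smul_eq_zero] at h
    exact h.elim ha (D.fderiv_rho_ne hy)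
  refine ⟨-(b⁻¹ * a), ?_⟩
  have h' : b • fderiv ℝ (f : _ → ℝ) y = -(a • fderiv ℝ (D.rho : _ → ℝ) y) :=
    eq_neg_of_add_eq_zero_right h
  calc fderiv ℝ (f : _ → ℝ) y = b⁻¹ • b • fderiv ℝ (f : _ → ℝ) y := by
        rw [smul_smul, inv_mul_cancel₀ hb, one_smul]
    _ = _ := by ext x; simp [h', mul_assoc]

/-- Near a boundary point, a function vanishing on the boundary is `O(ρ)`. -/
theorem eventually_le_rho_of_frontier {f : SmoothFun (Fin d → ℝ)} (hf : D.VanishOn f)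
    {y₀ : Fin d → ℝ} (hy₀ : y₀ ∈ frontier D.carrier) :
    ∃ C : ℝ, ∀ᶠ y in nhds y₀, y ∈ D.carrier → |(f : _ → ℝ) y| ≤ C * |(D.rho : _ → ℝ) y| := by
  obtain ⟨e, he⟩ : ∃ e, fderiv ℝ (D.rho : _ → ℝ) y₀ e ≠ 0 := by
    by_contra! h
    exact D.fderiv_rho_ne hy₀ (ContinuousLinearMap.ext h)
  wlog hpos : 0 < fderiv ℝ (D.rho : _ → ℝ) y₀ e generalizing e
  · refine this (-e) (by simpa using he) ?_
    simp only [map_neg, Left.neg_pos_iff]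
    exact lt_of_le_of_ne (not_lt.1 hpos) he
  set c := fderiv ℝ (D.rho : _ → ℝ) y₀ e / 2 with hc
  have hcpos : 0 < c := by positivity
  have hcont : Continuous fun y => fderiv ℝ (D.rho : _ → ℝ) y e := (SmoothFun.dir e D.rho).continuous
  have hcontf : Continuous fun y => fderiv ℝ (f : _ → ℝ) y e := (SmoothFun.dir e f).continuous
  set B := |fderiv ℝ (f : _ → ℝ) y₀ e| + 1 with hB
  have ev1 : ∀ᶠ y in nhds y₀, c < fderiv ℝ (D.rho : _ → ℝ) y e :=
    hcont.continuousAt.eventually (lt_mem_nhds (by rw [hc]; linarith))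
  have ev2 : ∀ᶠ y in nhds y₀, |fderiv ℝ (f : _ → ℝ) y e| < B :=
    hcontf.abs.continuousAt.eventually (gt_mem_nhds (by rw [hB]; linarith))
  -- all the points `y + s e` with `y` near `y₀` and `s` small are near `y₀`
  have hlim : Filter.Tendsto (fun p : (Fin d → ℝ) × ℝ => p.1 + p.2 • e)
      (nhds (y₀, 0)) (nhds y₀) := by
    have : Continuous (fun p : (Fin d → ℝ) × ℝ => p.1 + p.2 • e) := by fun_prop
    simpa using this.tendsto (y₀, 0)
  have ev := hlim.eventually (ev1.and ev2)
  rw [nhds_prod_eq, Filter.eventually_prod_iff] at ev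
  obtain ⟨p, hp, q, hq, hpq⟩ := ev
  obtain ⟨r, hr, hrq⟩ := Metric.eventually_nhds_iff.1 hq
  have ev3 : ∀ᶠ y in nhds y₀, |(D.rho : _ → ℝ) y| < c * (r / 2) := by
    have : |(D.rho : _ → ℝ) y₀| < c * (r / 2) := by
      rw [D.mem_frontier_iff.1 hy₀, abs_zero]; positivity
    exact D.rho.continuous.abs.continuousAt.eventually (gt_mem_nhds this)
  refine ⟨B / c, ?_⟩
  filter_upwards [hp, ev3] with y hy1 hy3 hyΩ
  have hneg := D.mem_carrier_iff.1 hyΩ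
  have hseg : ∀ s ∈ Set.Icc (0 : ℝ) (r / 2), c < fderiv ℝ (D.rho : _ → ℝ) (y + s • e) e ∧
      |fderiv ℝ (f : _ → ℝ) (y + s • e) e| < B := by
    intro s hs
    refine hpq hy1 (hrq ?_)
    rw [Real.dist_eq, sub_zero, abs_of_nonneg hs.1]
    linarith [hs.2]
  have hder : ∀ (g : SmoothFun (Fin d → ℝ)) (s : ℝ),
      HasDerivAt (fun s : ℝ => (g : _ → ℝ) (y + s • e))
        (fderiv ℝ (g : _ → ℝ) (y + s • e) e) s := by
    intro g s
    have h1 : HasDerivAt (fun s : ℝ => y + s • e) e s := by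
      simpa using ((hasDerivAt_id s).smul_const e).const_add y
    exact (g.differentiable _).hasFDerivAt.comp_hasDerivAt s h1
  have hrho : ∀ s ∈ Set.Icc (0 : ℝ) (r / 2),
      (D.rho : _ → ℝ) y + c * s ≤ (D.rho : _ → ℝ) (y + s • e) := by
    intro s hs
    have := (convex_Icc (0 : ℝ) (r / 2)).mul_sub_le_image_sub_of_le_deriv
      (f := fun s : ℝ => (D.rho : _ → ℝ) (y + s • e))
      (fun s _ => (hder D.rho s).continuousAt.continuousWithinAt)
      (fun s _ => (hder D.rho s).differentiableAt.differentiableWithinAt)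
      (C := c) (fun s hs => by
        rw [(hder D.rho s).deriv]; exact (hseg s (interior_subset hs)).1.le)
      0 ⟨le_rfl, by positivity⟩ s hs hs.1
    simp only [zero_smul, add_zero, sub_zero] at this
    linarith
  obtain ⟨s, hs, hs0⟩ : ∃ s ∈ Set.Icc (0 : ℝ) (r / 2), (D.rho : _ → ℝ) (y + s • e) = 0 := by
    have hcontρ : ContinuousOn (fun s : ℝ => (D.rho : _ → ℝ) (y + s • e)) (Set.Icc 0 (r / 2)) :=
      fun s _ => (hder D.rho s).continuousAt.continuousWithinAt
    have := intermediate_value_Icc (by positivity : (0 : ℝ) ≤ r / 2) hcontρ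
    refine this ⟨by simpa using hneg.le, ?_⟩
    have h2 := hrho (r / 2) ⟨by positivity, le_rfl⟩
    have := neg_abs_le ((D.rho : _ → ℝ) y)
    linarith
  have h4 := hrho s hs
  rw [hs0] at h4
  have h5 : |(f : _ → ℝ) (y + s • e) - (f : _ → ℝ) y| ≤ B * s := by
    have := (convex_Icc (0 : ℝ) (r / 2)).norm_image_sub_le_of_norm_deriv_le
      (f := fun s : ℝ => (f : _ → ℝ) (y + s • e)) (C := B)
      (fun s _ => (hder f s).differentiableAt)
      (fun s hs => by rw [(hder f s).deriv]; exact (hseg s hs).2.le)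
      (x := 0) (y := s) ⟨le_rfl, by positivity⟩ hs
    simpa [abs_of_nonneg hs.1] using this
  rw [hf _ (D.mem_frontier_iff.2 hs0), zero_sub, abs_neg] at h5
  rw [abs_of_neg hneg]
  have hBpos : 0 < B := by positivity
  calc |(f : _ → ℝ) y| ≤ B * s := h5
    _ = B / c * (c * s) := by field_simp
    _ ≤ B / c * -(D.rho : _ → ℝ) y := by gcongr; linarith

theorem exists_le_rho {f : SmoothFun (Fin d → ℝ)} (hf : D.VanishOn f) :
    ∃ C : ℝ, ∀ y ∈ D.carrier, |(f : _ → ℝ) y| ≤ C * |(D.rho : _ → ℝ) y| := by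
  have key : ∃ C : ℝ, ∀ y ∈ closure D.carrier, y ∈ D.carrier →
      |(f : _ → ℝ) y| ≤ C * |(D.rho : _ → ℝ) y| := by
    refine D.isCompact_closure.induction_on
      (p := fun s => ∃ C : ℝ, ∀ y ∈ s, y ∈ D.carrier → |(f : _ → ℝ) y| ≤ C * |(D.rho : _ → ℝ) y|)
      ⟨0, by simp⟩ ?_ ?_ ?_
    · rintro s t hst ⟨C, hC⟩
      exact ⟨C, fun y hy => hC y (hst hy)⟩
    · rintro s t ⟨C, hC⟩ ⟨C', hC'⟩
      refine ⟨max C C', fun y hy hyΩ => ?_⟩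
      rcases hy with hy | hy
      · exact (hC y hy hyΩ).trans (by gcongr; exact le_max_left _ _)
      · exact (hC' y hy hyΩ).trans (by gcongr; exact le_max_right _ _)
    · intro y₀ hy₀
      rw [closure_eq_self_union_frontier] at hy₀
      rcases hy₀ with h | h
      · have hneg := D.mem_carrier_iff.1 h
        have ev1 : ∀ᶠ y in nhds y₀, |(D.rho : _ → ℝ) y₀| / 2 < |(D.rho : _ → ℝ) y| :=
          D.rho.continuous.abs.continuousAt.eventually
            (lt_mem_nhds (by linarith [abs_pos.2 hneg.ne]))
        have ev2 : ∀ᶠ y in nhds y₀, |(f : _ → ℝ) y| < |(f : _ → ℝ) y₀| + 1 :=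
          f.continuous.abs.continuousAt.eventually (gt_mem_nhds (by linarith))
        refine ⟨_, mem_nhdsWithin_of_mem_nhds (ev1.and ev2),
          (|(f : _ → ℝ) y₀| + 1) / (|(D.rho : _ → ℝ) y₀| / 2), ?_⟩
        rintro y ⟨h1, h2⟩ -
        have h0 : 0 < |(D.rho : _ → ℝ) y₀| / 2 := by linarith [abs_pos.2 hneg.ne]
        calc |(f : _ → ℝ) y| ≤ |(f : _ → ℝ) y₀| + 1 := h2.le
          _ = (|(f : _ → ℝ) y₀| + 1) / (|(D.rho : _ → ℝ) y₀| / 2) * (|(D.rho : _ → ℝ) y₀| / 2) :=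
            (div_mul_cancel₀ _ h0.ne').symm
          _ ≤ _ := by gcongr
      · obtain ⟨C, hC⟩ := D.eventually_le_rho_of_frontier hf h
        exact ⟨_, mem_nhdsWithin_of_mem_nhds hC, C, fun y hy => hy⟩
  obtain ⟨C, hC⟩ := key
  exact ⟨C, fun y hy => hC y (subset_closure hy) hy⟩

/-- A cutoff function supported in the domain, at distance `1 / n` from the boundary. -/
def cutoff (n : ℕ) : SmoothFun (Fin d → ℝ) :=
  ⟨fun y => Real.smoothTransition (-(n * (D.rho : _ → ℝ) y) - 1),
    Real.smoothTransition.contDiff.comp (((contDiff_const.mul D.rho.contDiff).neg).sub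
      contDiff_const)⟩

theorem cutoff_apply (n : ℕ) (y : Fin d → ℝ) : (D.cutoff n : _ → ℝ) y =
    Real.smoothTransition (-(n * (D.rho : _ → ℝ) y) - 1) := rfl

theorem fderiv_cutoff (n : ℕ) (y a : Fin d → ℝ) : fderiv ℝ (D.cutoff n : _ → ℝ) y a =
    -(n * deriv Real.smoothTransition (-(n * (D.rho : _ → ℝ) y) - 1) *
      fderiv ℝ (D.rho : _ → ℝ) y a) := by
  have h1 : HasDerivAt Real.smoothTransition
      (deriv Real.smoothTransition (-(n * (D.rho : _ → ℝ) y) - 1))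
      (-(n * (D.rho : _ → ℝ) y) - 1) :=
    ((Real.smoothTransition.contDiff (n := 1)).differentiable (by simp) _).hasDerivAt
  have h2 : HasFDerivAt (fun y => -(n * (D.rho : _ → ℝ) y) - 1)
      (-((n : ℝ) • fderiv ℝ (D.rho : _ → ℝ) y)) y :=
    (((D.rho.differentiable y).hasFDerivAt.const_mul (n : ℝ)).neg).sub_const 1
  have h3 := h1.comp_hasFDerivAt y h2
  have : fderiv ℝ (D.cutoff n : _ → ℝ) y = _ := h3.fderiv
  rw [this]
  simp
  ring

theorem cutoff_eq_zero (n : ℕ) {y : Fin d → ℝ} (hy : y ∉ D.carrier) :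
    (D.cutoff n : _ → ℝ) y = 0 := by
  rw [D.mem_carrier_iff, not_lt] at hy
  refine Real.smoothTransition.zero_of_nonpos ?_
  have : (0 : ℝ) ≤ n * (D.rho : _ → ℝ) y := by positivity
  linarith

theorem hasCompactSupport_cutoff (n : ℕ) : HasCompactSupport (D.cutoff n : (Fin d → ℝ) → ℝ) :=
  HasCompactSupport.intro D.isCompact_closure fun _ hy =>
    D.cutoff_eq_zero n fun h => hy (subset_closure h)

theorem integral_cutoff_mul (n : ℕ) (f : SmoothFun (Fin d → ℝ)) (a : Fin d → ℝ) :
    ∫ y in D.carrier, (D.cutoff n : _ → ℝ) y * fderiv ℝ (f : _ → ℝ) y a =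
      -∫ y in D.carrier, fderiv ℝ (D.cutoff n : _ → ℝ) y a * (f : _ → ℝ) y := by
  have hc := D.hasCompactSupport_cutoff n
  obtain ⟨B, -, -, hB, -⟩ := exists_bound_deriv_smoothTransition
  have hz : ∀ y ∉ D.carrier, fderiv ℝ (D.cutoff n : _ → ℝ) y a = 0 := by
    intro y hy
    rw [D.fderiv_cutoff, hB]
    · simp
    · rw [D.mem_carrier_iff, not_lt] at hy
      have : (0 : ℝ) ≤ n * (D.rho : _ → ℝ) y := by positivity
      linarith
  rw [setIntegral_eq_integral_of_forall_compl_eq_zero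
      (fun y hy => by rw [D.cutoff_eq_zero n hy, zero_mul]),
    setIntegral_eq_integral_of_forall_compl_eq_zero (fun y hy => by rw [hz y hy, zero_mul])]
  refine integral_mul_fderiv_eq_neg_fderiv_mul_of_integrable ?_ ?_ ?_
    (fun y _ => (D.cutoff n).differentiable y) (fun y _ => f.differentiable y)
  · refine Continuous.integrable_of_hasCompactSupport
      ((SmoothFun.dir a (D.cutoff n)).continuous.mul f.continuous) ?_
    exact HasCompactSupport.intro D.isCompact_closure fun y hy => by
      rw [hz y fun h => hy (subset_closure h), zero_mul]
  · exact Continuous.integrable_of_hasCompactSupport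
      ((D.cutoff n).continuous.mul (SmoothFun.dir a f).continuous) hc.mul_right
  · exact Continuous.integrable_of_hasCompactSupport
      ((D.cutoff n).continuous.mul f.continuous) hc.mul_right

/-- The partial derivative in the `i`-th coordinate direction. -/
abbrev _root_.SmoothFun.pder (i : Fin d) :
    Derivation ℝ (SmoothFun (Fin d → ℝ)) (SmoothFun (Fin d → ℝ)) :=
  SmoothFun.dir (Pi.single i 1)

open SmoothFun

/-- Divergence theorem for vector fields that are tangent to the boundary. -/
theorem integral_div_eq_zero (F : Fin d → SmoothFun (Fin d → ℝ))
    (hF : D.VanishOn (∑ i, F i * pder i D.rho)) :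
    ∫ y in D.carrier, ((∑ i, pder i (F i) : SmoothFun (Fin d → ℝ)) : _ → ℝ) y = 0 := by
  set g : SmoothFun (Fin d → ℝ) := ∑ i, F i * pder i D.rho with hg
  set f : SmoothFun (Fin d → ℝ) := ∑ i, pder i (F i) with hf
  obtain ⟨B, hB0, hB, hBneg, hBone⟩ := exists_bound_deriv_smoothTransition
  obtain ⟨C, hC⟩ := D.exists_le_rho hF
  have hid : ∀ n : ℕ, ∫ y in D.carrier, (D.cutoff n : _ → ℝ) y * (f : _ → ℝ) y =
      ∫ y in D.carrier, n * deriv Real.smoothTransition (-(n * (D.rho : _ → ℝ) y) - 1) *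
        (g : _ → ℝ) y := by
    intro n
    have e1 : ∀ y, (D.cutoff n : _ → ℝ) y * (f : _ → ℝ) y =
        ∑ i, (D.cutoff n : _ → ℝ) y * fderiv ℝ (F i : (Fin d → ℝ) → ℝ) y (Pi.single i (1 : ℝ)) := by
      intro y
      simp [hf, Finset.mul_sum]
    have e2 : ∀ y, n * deriv Real.smoothTransition (-(n * (D.rho : _ → ℝ) y) - 1) *
        (g : _ → ℝ) y =
        ∑ i, -(fderiv ℝ (D.cutoff n : _ → ℝ) y (Pi.single i (1 : ℝ)) * (F i : _ → ℝ) y) := by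
      intro y
      simp only [D.fderiv_cutoff, hg, AddSubmonoidClass.coe_finsetSum, Finset.sum_apply,
        Finset.mul_sum]
      refine Finset.sum_congr rfl fun i _ => ?_
      simp
      ring
    simp_rw [e1, e2]
    rw [integral_finsetSum, integral_finsetSum]
    · refine Finset.sum_congr rfl fun i _ => ?_
      rw [D.integral_cutoff_mul, integral_neg]
    · intro i _
      exact (D.integrableOn ((dir _ (D.cutoff n)).continuous.mul (F i).continuous)).neg
    · intro i _
      exact D.integrableOn ((D.cutoff n).continuous.mul (dir _ (F i)).continuous)
  have hlarge : ∀ y ∈ D.carrier, ∀ᶠ n : ℕ in Filter.atTop,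
      1 < -(n * (D.rho : _ → ℝ) y) - 1 := by
    intro y hy
    have hneg := D.mem_carrier_iff.1 hy
    have : Filter.Tendsto (fun n : ℕ => (n : ℝ) * (-(D.rho : _ → ℝ) y)) Filter.atTop
        Filter.atTop := tendsto_natCast_atTop_atTop.atTop_mul_const (by linarith)
    filter_upwards [this.eventually_gt_atTop 2] with n hn
    linarith
  have lim1 : Filter.Tendsto (fun n : ℕ => ∫ y in D.carrier, (D.cutoff n : _ → ℝ) y * (f : _ → ℝ) y)
      Filter.atTop (nhds (∫ y in D.carrier, (f : _ → ℝ) y)) := by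
    refine tendsto_integral_of_dominated_convergence (fun y => |(f : _ → ℝ) y|) ?_ ?_ ?_ ?_
    · intro n
      exact ((D.cutoff n).continuous.mul f.continuous).aestronglyMeasurable
    · exact D.integrableOn f.continuous.abs
    · intro n
      refine Filter.Eventually.of_forall fun y => ?_
      rw [norm_mul, Real.norm_eq_abs, Real.norm_eq_abs, D.cutoff_apply,
        abs_of_nonneg (Real.smoothTransition.nonneg _)]
      exact mul_le_of_le_one_left (abs_nonneg _) (Real.smoothTransition.le_one _)
    · filter_upwards [ae_restrict_mem D.measurableSet] with y hy
      refine tendsto_const_nhds.congr' ?_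
      filter_upwards [hlarge y hy] with n hn
      rw [D.cutoff_apply, Real.smoothTransition.one_of_one_le hn.le, one_mul]
  have lim2 : Filter.Tendsto (fun n : ℕ => ∫ y in D.carrier,
      n * deriv Real.smoothTransition (-(n * (D.rho : _ → ℝ) y) - 1) * (g : _ → ℝ) y)
      Filter.atTop (nhds (∫ y in D.carrier, (0 : ℝ))) := by
    refine tendsto_integral_of_dominated_convergence (fun _ => 2 * B * |C|) ?_ ?_ ?_ ?_
    · intro n
      have hc : Continuous (deriv Real.smoothTransition) :=
        (Real.smoothTransition.contDiff (n := 1)).continuous_deriv (by simp)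
      have h1 := D.rho.continuous
      have h2 := g.continuous
      exact Continuous.aestronglyMeasurable (by fun_prop)
    · exact D.integrableOn continuous_const
    · intro n
      filter_upwards [ae_restrict_mem D.measurableSet] with y hy
      have hneg := D.mem_carrier_iff.1 hy
      by_cases h : 1 < -(n * (D.rho : _ → ℝ) y) - 1
      · rw [hBone _ h]
        simp
        positivity
      · have h2 : n * |(D.rho : _ → ℝ) y| ≤ 2 := by rw [abs_of_neg hneg]; linarith
        calc ‖n * deriv Real.smoothTransition (-(n * (D.rho : _ → ℝ) y) - 1) * (g : _ → ℝ) y‖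
            = n * |deriv Real.smoothTransition (-(n * (D.rho : _ → ℝ) y) - 1)| *
              |(g : _ → ℝ) y| := by simp
          _ ≤ n * B * (|C| * |(D.rho : _ → ℝ) y|) := by
              gcongr
              · exact hB _
              · exact (hC y hy).trans (by gcongr; exact le_abs_self C)
          _ = (n * |(D.rho : _ → ℝ) y|) * B * |C| := by ring
          _ ≤ 2 * B * |C| := by gcongr
    · filter_upwards [ae_restrict_mem D.measurableSet] with y hy
      refine tendsto_const_nhds.congr' ?_
      filter_upwards [hlarge y hy] with n hn
      rw [hBone _ hn]
      simp
  simp_rw [hid] at lim1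
  rw [tendsto_nhds_unique lim1 lim2]
  simp

end SmoothDomain

namespace SmoothDomain

open SmoothFun

variable {d : ℕ} (D : SmoothDomain d)

theorem memLp_two (f : SmoothFun (Fin d → ℝ)) :
    MemLp (f : (Fin d → ℝ) → ℝ) 2 (volume.restrict D.carrier) :=
  (memLp_two_iff_integrable_sq f.continuous.aestronglyMeasurable).2
    (D.integrableOn (f.continuous.pow 2))

/-- Restriction of a smooth function to the domain, as an element of `L²`. -/
def toL2 : SmoothFun (Fin d → ℝ) →ₗ[ℝ] Lp ℝ 2 (volume.restrict D.carrier) where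
  toFun f := (D.memLp_two f).toLp
  map_add' f g := MemLp.toLp_add (D.memLp_two f) (D.memLp_two g)
  map_smul' c f := MemLp.toLp_const_smul c (D.memLp_two f)

theorem inner_toL2 (f g : SmoothFun (Fin d → ℝ)) :
    inner ℝ (D.toL2 f) (D.toL2 g) =
      ∫ y in D.carrier, ((f * g : SmoothFun (Fin d → ℝ)) : _ → ℝ) y := by
  rw [L2.inner_def]
  refine integral_congr_ae ?_
  filter_upwards [(D.memLp_two f).coeFn_toLp, (D.memLp_two g).coeFn_toLp] with y h1 h2
  change inner ℝ (MemLp.toLp _ (D.memLp_two f) y) (MemLp.toLp _ (D.memLp_two g) y) = _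
  rw [h1, h2]
  simp [mul_comm]

/-- The `L²` norm over the domain. -/
def nrm (f : SmoothFun (Fin d → ℝ)) : ℝ := ‖D.toL2 f‖

theorem nrm_nonneg (f : SmoothFun (Fin d → ℝ)) : 0 ≤ D.nrm f := norm_nonneg _

theorem nrm_sq (f : SmoothFun (Fin d → ℝ)) :
    D.nrm f ^ 2 = ∫ y in D.carrier, ((f : _ → ℝ) y) ^ 2 := by
  rw [nrm, ← real_inner_self_eq_norm_sq, inner_toL2]
  simp [sq]

theorem nrm_eq_sqrt (f : SmoothFun (Fin d → ℝ)) :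
    D.nrm f = Real.sqrt (∫ y in D.carrier, ((f : _ → ℝ) y) ^ 2) := by
  rw [← D.nrm_sq, Real.sqrt_sq (D.nrm_nonneg f)]

theorem abs_integral_mul_le (f g : SmoothFun (Fin d → ℝ)) :
    |∫ y in D.carrier, ((f * g : SmoothFun (Fin d → ℝ)) : _ → ℝ) y| ≤ D.nrm f * D.nrm g := by
  rw [← inner_toL2]
  exact abs_real_inner_le_norm _ _

theorem nrm_mul_le (a : SmoothFun (Fin d → ℝ)) :
    ∃ C, 0 ≤ C ∧ ∀ f, D.nrm (a * f) ≤ C * D.nrm f := by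
  obtain ⟨C, hC⟩ := D.isCompact_closure.exists_bound_of_continuousOn a.continuous.continuousOn
  refine ⟨|C|, abs_nonneg C, fun f => ?_⟩
  refine abs_le_of_sq_le_sq' ?_ (mul_nonneg (abs_nonneg C) (D.nrm_nonneg f)) |>.2
  rw [mul_pow, D.nrm_sq, D.nrm_sq, ← integral_const_mul]
  refine setIntegral_mono_on (D.integrableOn ((a * f).continuous.pow 2))
    (D.integrableOn (continuous_const.mul (f.continuous.pow 2))) D.measurableSet fun y hy => ?_
  have h1 : |(a : _ → ℝ) y| ≤ |C| := (hC y (subset_closure hy)).trans (le_abs_self C)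
  have h2 : ((a : _ → ℝ) y) ^ 2 ≤ |C| ^ 2 := by
    rw [← sq_abs]; gcongr
  simp only [MulMemClass.coe_mul, Pi.mul_apply, mul_pow]
  gcongr

/-- The Sobolev norm of order `k` over the domain. -/
def sob : ℕ → SmoothFun (Fin d → ℝ) → ℝ
  | 0, f => D.nrm f
  | k + 1, f => D.nrm f + ∑ i, sob k (pder i f)

theorem sob_succ (k : ℕ) (f : SmoothFun (Fin d → ℝ)) :
    D.sob (k + 1) f = D.nrm f + ∑ i, D.sob k (pder i f) := rfl

theorem sob_nonneg (k : ℕ) (f : SmoothFun (Fin d → ℝ)) : 0 ≤ D.sob k f := by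
  induction k generalizing f with
  | zero => exact D.nrm_nonneg f
  | succ k ih => exact add_nonneg (D.nrm_nonneg f) (Finset.sum_nonneg fun i _ => ih _)

theorem sob_zero (k : ℕ) : D.sob k 0 = 0 := by
  induction k with
  | zero => simp [sob, nrm]
  | succ k ih => simp [sob, nrm, ih]

theorem sob_add_le (k : ℕ) (f g : SmoothFun (Fin d → ℝ)) :
    D.sob k (f + g) ≤ D.sob k f + D.sob k g := by
  induction k generalizing f g with
  | zero =>
    simp only [sob, nrm, map_add]
    exact norm_add_le _ _
  | succ k ih =>
    have h0 : D.nrm (f + g) ≤ D.nrm f + D.nrm g := by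
      simp only [nrm, map_add]
      exact norm_add_le _ _
    have h1 : ∑ i, D.sob k (pder i (f + g)) ≤
        ∑ i, D.sob k (pder i f) + ∑ i, D.sob k (pder i g) := by
      rw [← Finset.sum_add_distrib]
      refine Finset.sum_le_sum fun i _ => ?_
      rw [map_add]
      exact ih _ _
    simp only [sob_succ]
    linarith

theorem sob_neg (k : ℕ) (f : SmoothFun (Fin d → ℝ)) : D.sob k (-f) = D.sob k f := by
  induction k generalizing f with
  | zero => simp [sob, nrm]
  | succ k ih => simp [sob, nrm, ih]

theorem sob_sub_le (k : ℕ) (f g : SmoothFun (Fin d → ℝ)) :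
    D.sob k (f - g) ≤ D.sob k f + D.sob k g := by
  rw [sub_eq_add_neg, ← D.sob_neg k g]
  exact D.sob_add_le k _ _

theorem sob_le_succ (k : ℕ) (f : SmoothFun (Fin d → ℝ)) : D.sob k f ≤ D.sob (k + 1) f := by
  induction k generalizing f with
  | zero => exact le_add_of_nonneg_right (Finset.sum_nonneg fun i _ => D.sob_nonneg _ _)
  | succ k ih =>
    rw [sob_succ, sob_succ]
    gcongr
    exact ih _

theorem sob_mono {k l : ℕ} (h : k ≤ l) (f : SmoothFun (Fin d → ℝ)) : D.sob k f ≤ D.sob l f :=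
  monotone_nat_of_le_succ (fun n => D.sob_le_succ n f) h

theorem nrm_le_sob (k : ℕ) (f : SmoothFun (Fin d → ℝ)) : D.nrm f ≤ D.sob k f :=
  D.sob_mono (Nat.zero_le k) f

theorem sob_pder_le (k : ℕ) (i : Fin d) (f : SmoothFun (Fin d → ℝ)) :
    D.sob k (pder i f) ≤ D.sob (k + 1) f := by
  rw [sob_succ]
  have := Finset.single_le_sum (f := fun i => D.sob k (pder i f))
    (fun i _ => D.sob_nonneg _ _) (Finset.mem_univ i)
  have := D.nrm_nonneg f
  linarith

theorem sob_mul_le (k : ℕ) (a : SmoothFun (Fin d → ℝ)) :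
    ∃ C, 0 ≤ C ∧ ∀ f, D.sob k (a * f) ≤ C * D.sob k f := by
  induction k generalizing a with
  | zero => exact D.nrm_mul_le a
  | succ k ih =>
    obtain ⟨C, hC0, hC⟩ := D.nrm_mul_le a
    obtain ⟨C', hC0', hC'⟩ := ih a
    choose B hB0 hB using fun i => ih (pder i a)
    refine ⟨C + C' + ∑ i, B i, add_nonneg (add_nonneg hC0 hC0')
      (Finset.sum_nonneg fun i _ => hB0 i), fun f => ?_⟩
    rw [D.sob_succ k (a * f)]
    have h1 : ∀ i, D.sob k (pder i (a * f)) ≤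
        C' * D.sob k (pder i f) + B i * D.sob (k + 1) f := by
      intro i
      rw [dir_mul]
      refine (D.sob_add_le k _ _).trans (add_le_add (hC' _) ?_)
      rw [mul_comm]
      exact (hB i f).trans (by gcongr; exacts [hB0 i, D.sob_le_succ k f])
    have h2 : ∑ i, D.sob k (pder i (a * f)) ≤
        C' * ∑ i, D.sob k (pder i f) + (∑ i, B i) * D.sob (k + 1) f := by
      rw [Finset.mul_sum, Finset.sum_mul, ← Finset.sum_add_distrib]
      exact Finset.sum_le_sum fun i _ => h1 i
    have h3 : ∑ i, D.sob k (pder i f) ≤ D.sob (k + 1) f := by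
      rw [sob_succ]; linarith [D.nrm_nonneg f]
    calc _ ≤ C * D.sob (k + 1) f + (C' * D.sob (k + 1) f + (∑ i, B i) * D.sob (k + 1) f) := by
          refine add_le_add ((hC f).trans ?_) (h2.trans ?_)
          · exact mul_le_mul_of_nonneg_left (D.nrm_le_sob _ f) hC0
          · gcongr
      _ = _ := by ring

/-- The operators whose `k`-th Sobolev norm is dominated by the functional `G`. -/
def Dom (k : ℕ) (G : SmoothFun (Fin d → ℝ) → ℝ) :
    Submodule (SmoothFun (Fin d → ℝ)) (SmoothFun (Fin d → ℝ) → SmoothFun (Fin d → ℝ)) where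
  carrier := {A | ∃ C, ∀ v, D.sob k (A v) ≤ C * G v}
  add_mem' := by
    rintro A B ⟨C, hC⟩ ⟨C', hC'⟩
    refine ⟨C + C', fun v => (D.sob_add_le k _ _).trans ?_⟩
    rw [add_mul]
    exact add_le_add (hC v) (hC' v)
  zero_mem' := ⟨0, fun v => by simp [D.sob_zero]⟩
  smul_mem' := by
    rintro a A ⟨C, hC⟩
    obtain ⟨B, hB0, hB⟩ := D.sob_mul_le k a
    refine ⟨B * C, fun v => (hB (A v)).trans ?_⟩
    rw [mul_assoc]
    exact mul_le_mul_of_nonneg_left (hC v) hB0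

theorem mem_Dom_of_le {k : ℕ} {G : SmoothFun (Fin d → ℝ) → ℝ}
    {A : SmoothFun (Fin d → ℝ) → SmoothFun (Fin d → ℝ)} (h : ∀ v, D.sob k (A v) ≤ G v) :
    A ∈ D.Dom k G := ⟨1, fun v => by simpa using h v⟩

theorem exists_pos_of_mem_Dom {k : ℕ} {G : SmoothFun (Fin d → ℝ) → ℝ} (hG : ∀ v, 0 ≤ G v)
    {A : SmoothFun (Fin d → ℝ) → SmoothFun (Fin d → ℝ)} (h : A ∈ D.Dom k G) :
    ∃ C, 0 ≤ C ∧ ∀ v, D.sob k (A v) ≤ C * G v := by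
  obtain ⟨C, hC⟩ := h
  exact ⟨|C|, abs_nonneg C, fun v => (hC v).trans (by gcongr; exacts [hG v, le_abs_self C])⟩

end SmoothDomain
namespace SmoothFun

variable {d : ℕ}

/-- The vector field with coefficients `a`, as a differential operator. -/
def vf (a : Fin d → SmoothFun (Fin d → ℝ)) (v : SmoothFun (Fin d → ℝ)) :
    SmoothFun (Fin d → ℝ) := ∑ i, a i * pder i v

/-- The Laplacian. -/
def lap (v : SmoothFun (Fin d → ℝ)) : SmoothFun (Fin d → ℝ) := ∑ i, pder i (pder i v)

theorem pder_vf (j : Fin d) (a : Fin d → SmoothFun (Fin d → ℝ)) (v : SmoothFun (Fin d → ℝ)) :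
    pder j (vf a v) = vf a (pder j v) + vf (fun i => pder j (a i)) v := by
  simp only [vf, map_sum, dir_mul, Finset.sum_add_distrib]
  congr 1
  · exact Finset.sum_congr rfl fun i _ => by rw [dir_comm]
  · exact Finset.sum_congr rfl fun i _ => mul_comm _ _

/-- The commutator of the Laplacian with a vector field. -/
def commLap (a : Fin d → SmoothFun (Fin d → ℝ)) (v : SmoothFun (Fin d → ℝ)) :
    SmoothFun (Fin d → ℝ) :=
  ∑ j, (vf (fun i => pder j (a i)) (pder j v) + vf (fun i => pder j (a i)) (pder j v) +
    vf (fun i => pder j (pder j (a i))) v)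

theorem vf_sum {ι : Type*} (s : Finset ι) (a : Fin d → SmoothFun (Fin d → ℝ))
    (v : ι → SmoothFun (Fin d → ℝ)) : vf a (∑ j ∈ s, v j) = ∑ j ∈ s, vf a (v j) := by
  simp only [vf, map_sum, Finset.mul_sum]
  rw [Finset.sum_comm]

theorem lap_vf (a : Fin d → SmoothFun (Fin d → ℝ)) (v : SmoothFun (Fin d → ℝ)) :
    lap (vf a v) = vf a (lap v) + commLap a v := by
  rw [lap, lap, commLap, vf_sum, ← Finset.sum_add_distrib]
  refine Finset.sum_congr rfl fun j _ => ?_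
  rw [pder_vf, map_add, pder_vf, pder_vf]
  abel

end SmoothFun
namespace SmoothDomain
open SmoothFun
variable {d : ℕ} (D : SmoothDomain d)

theorem sum_mul_mem {M : Submodule (SmoothFun (Fin d → ℝ))
    (SmoothFun (Fin d → ℝ) → SmoothFun (Fin d → ℝ))} {ι : Type*} (s : Finset ι)
    (a : ι → SmoothFun (Fin d → ℝ)) (A : ι → SmoothFun (Fin d → ℝ) → SmoothFun (Fin d → ℝ))
    (h : ∀ i ∈ s, A i ∈ M) : (fun v => ∑ i ∈ s, a i * A i v) ∈ M := by
  have : (fun v => ∑ i ∈ s, a i * A i v) = ∑ i ∈ s, a i • A i := by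
    ext1 v; simp
  rw [this]
  exact M.sum_mem fun i hi => M.smul_mem _ (h i hi)

theorem vf_mem_Dom (k : ℕ) (a : Fin d → SmoothFun (Fin d → ℝ)) :
    vf a ∈ D.Dom k (D.sob (k + 1)) :=
  sum_mul_mem _ a (fun i v => pder i v) fun i _ => D.mem_Dom_of_le fun v => D.sob_pder_le k i v

theorem vf_pder_mem_Dom (k : ℕ) (a : Fin d → SmoothFun (Fin d → ℝ)) (j : Fin d) :
    (fun v => vf a (pder j v)) ∈ D.Dom k (D.sob (k + 2)) :=
  sum_mul_mem _ a (fun i v => pder i (pder j v)) fun i _ => D.mem_Dom_of_le fun v =>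
    (D.sob_pder_le k i _).trans (D.sob_pder_le (k + 1) j v)

theorem commLap_mem_Dom (k : ℕ) (a : Fin d → SmoothFun (Fin d → ℝ)) :
    commLap a ∈ D.Dom k (D.sob (k + 2)) := by
  have : commLap a = ∑ j, ((fun v => vf (fun i => pder j (a i)) (pder j v)) +
      (fun v => vf (fun i => pder j (a i)) (pder j v)) +
      vf (fun i => pder j (pder j (a i)))) := by
    ext1 v; simp [commLap]
  rw [this]
  refine Submodule.sum_mem _ fun j _ => Submodule.add_mem _ (Submodule.add_mem _ ?_ ?_) ?_
  · exact D.vf_pder_mem_Dom k _ j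
  · exact D.vf_pder_mem_Dom k _ j
  · obtain ⟨C, hC0, hC⟩ := D.exists_pos_of_mem_Dom (D.sob_nonneg _) (D.vf_mem_Dom k
      (fun i => pder j (pder j (a i))))
    exact ⟨C, fun v => (hC v).trans (by gcongr; exact D.sob_le_succ _ v)⟩

end SmoothDomain

namespace SmoothFun

variable {d : ℕ}

theorem vf_mul (a : Fin d → SmoothFun (Fin d → ℝ)) (f g : SmoothFun (Fin d → ℝ)) :
    vf a (f * g) = f * vf a g + g * vf a f := by
  simp only [vf, dir_mul, Finset.mul_sum, ← Finset.sum_add_distrib]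
  exact Finset.sum_congr rfl fun i _ => by ring

theorem vf_sub (a : Fin d → SmoothFun (Fin d → ℝ)) (f g : SmoothFun (Fin d → ℝ)) :
    vf a (f - g) = vf a f - vf a g := by
  simp only [vf, map_sub, mul_sub, Finset.sum_sub_distrib]

theorem vf_single (k : Fin d) (b v : SmoothFun (Fin d → ℝ)) :
    vf (Pi.single k b) v = b * pder k v := by
  rw [vf, Finset.sum_eq_single k]
  · simp
  · intro i _ hi
    simp [Pi.single_eq_of_ne hi]
  · simp

theorem vf_sub_coeff (a b : Fin d → SmoothFun (Fin d → ℝ)) (v : SmoothFun (Fin d → ℝ)) :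
    vf (a - b) v = vf a v - vf b v := by
  simp only [vf, Pi.sub_apply, sub_mul, Finset.sum_sub_distrib]

theorem vf_smul_coeff (c : SmoothFun (Fin d → ℝ)) (a : Fin d → SmoothFun (Fin d → ℝ))
    (v : SmoothFun (Fin d → ℝ)) : vf (c • a) v = c * vf a v := by
  simp only [vf, Pi.smul_apply, smul_eq_mul, Finset.mul_sum, mul_assoc]

/-- The Lie bracket of two vector fields. -/
def bracket (b a : Fin d → SmoothFun (Fin d → ℝ)) : Fin d → SmoothFun (Fin d → ℝ) :=
  fun l => vf b (a l) - vf a (b l)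

theorem vf_vf (a b : Fin d → SmoothFun (Fin d → ℝ)) (v : SmoothFun (Fin d → ℝ)) :
    vf b (vf a v) = ∑ i, ∑ j, b i * a j * pder i (pder j v) + ∑ j, vf b (a j) * pder j v := by
  conv_lhs => rw [vf]
  simp only [pder_vf, mul_add, Finset.sum_add_distrib]
  congr 1
  · refine Finset.sum_congr rfl fun i _ => ?_
    rw [vf, Finset.mul_sum]
    exact Finset.sum_congr rfl fun j _ => by rw [dir_comm]; ring
  · simp only [vf, Finset.mul_sum, Finset.sum_mul]
    rw [Finset.sum_comm]
    exact Finset.sum_congr rfl fun i _ => Finset.sum_congr rfl fun j _ => by ring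

theorem vf_comm (a b : Fin d → SmoothFun (Fin d → ℝ)) (v : SmoothFun (Fin d → ℝ)) :
    vf b (vf a v) = vf a (vf b v) + vf (bracket b a) v := by
  have h : ∑ i, ∑ j, b i * a j * pder i (pder j v) = ∑ i, ∑ j, a i * b j * pder i (pder j v) := by
    rw [Finset.sum_comm]
    exact Finset.sum_congr rfl fun i _ => Finset.sum_congr rfl fun j _ => by
      rw [dir_comm, mul_comm (b j)]
  rw [vf_vf a b, vf_vf b a, h, add_assoc]
  congr 1
  simp only [vf, bracket, sub_mul, Finset.sum_sub_distrib]
  abel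

end SmoothFun

namespace SmoothDomain

open SmoothFun

variable {d : ℕ} (D : SmoothDomain d)

/-- The gradient of the defining function. -/
def nu : Fin d → SmoothFun (Fin d → ℝ) := fun i => pder i D.rho

/-- The squared length of the gradient of the defining function. -/
def kap : SmoothFun (Fin d → ℝ) := ∑ i, D.nu i * D.nu i

theorem vf_nu_rho : vf D.nu D.rho = D.kap := rfl

theorem kap_nonneg (y : Fin d → ℝ) : 0 ≤ (D.kap : _ → ℝ) y := by
  simp only [kap, AddSubmonoidClass.coe_finsetSum, Finset.sum_apply, MulMemClass.coe_mul,
    Pi.mul_apply]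
  exact Finset.sum_nonneg fun i _ => mul_self_nonneg _

theorem kap_pos {y : Fin d → ℝ} (hy : y ∈ frontier D.carrier) : 0 < (D.kap : _ → ℝ) y := by
  refine lt_of_le_of_ne (D.kap_nonneg y) fun h => D.fderiv_rho_ne hy ?_
  simp only [kap, AddSubmonoidClass.coe_finsetSum, Finset.sum_apply, MulMemClass.coe_mul,
    Pi.mul_apply] at h
  have h0 := (Finset.sum_eq_zero_iff_of_nonneg fun i _ => mul_self_nonneg _).1 h.symm
  have h1 : ∀ i, fderiv ℝ (D.rho : _ → ℝ) y (Pi.single i 1) = 0 := fun i =>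
    mul_self_eq_zero.1 (h0 i (Finset.mem_univ i))
  refine ContinuousLinearMap.coe_injective (LinearMap.pi_ext' fun i => LinearMap.ext_ring ?_)
  simpa using h1 i

theorem exists_inv {f : SmoothFun (Fin d → ℝ)} (hf : ∀ y, (f : (Fin d → ℝ) → ℝ) y ≠ 0) :
    ∃ g : SmoothFun (Fin d → ℝ), g * f = 1 := by
  refine ⟨⟨(f : (Fin d → ℝ) → ℝ)⁻¹, f.contDiff.inv hf⟩, ?_⟩
  ext y
  simp [hf y]

theorem exists_inv_kap_add : ∃ g : SmoothFun (Fin d → ℝ), g * (D.kap + D.rho ^ 2) = 1 := by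
  refine exists_inv fun y => ne_of_gt ?_
  have h0 := D.kap_nonneg y
  by_cases h : (D.rho : _ → ℝ) y = 0
  · have := D.kap_pos (D.mem_frontier_iff.2 h)
    simp [h, this]
  · have : 0 < ((D.rho : _ → ℝ) y) ^ 2 := by positivity
    simp only [AddMemClass.coe_add, SubmonoidClass.coe_pow, Pi.add_apply, Pi.pow_apply]
    positivity

theorem exists_inv_kap_pow_add :
    ∃ g : SmoothFun (Fin d → ℝ), g * (D.kap ^ 4 + D.rho ^ 2) = 1 := by
  refine exists_inv fun y => ne_of_gt ?_
  have h0 := D.kap_nonneg y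
  by_cases h : (D.rho : _ → ℝ) y = 0
  · have := D.kap_pos (D.mem_frontier_iff.2 h)
    simp only [AddMemClass.coe_add, SubmonoidClass.coe_pow, Pi.add_apply, Pi.pow_apply]
    positivity
  · have : 0 < ((D.rho : _ → ℝ) y) ^ 2 := by positivity
    simp only [AddMemClass.coe_add, SubmonoidClass.coe_pow, Pi.add_apply, Pi.pow_apply]
    positivity

/-- A smooth function equal to `|∇ρ|⁻²` on the boundary. -/
def invKap : SmoothFun (Fin d → ℝ) := D.exists_inv_kap_add.choose

theorem invKap_mul_kap {y : Fin d → ℝ} (hy : y ∈ frontier D.carrier) :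
    (D.invKap : _ → ℝ) y * (D.kap : _ → ℝ) y = 1 := by
  have h := congrArg (fun f : SmoothFun (Fin d → ℝ) => (f : _ → ℝ) y) D.exists_inv_kap_add.choose_spec
  simpa [invKap, D.mem_frontier_iff.1 hy] using h

/-- The Dirichlet or the Neumann condition. -/
def BC (v : SmoothFun (Fin d → ℝ)) : Prop := D.VanishOn v ∨ D.VanishOn (vf D.nu v)

/-- Vector fields that are tangent to the boundary. -/
def Tangent (a : Fin d → SmoothFun (Fin d → ℝ)) : Prop := D.VanishOn (vf a D.rho)

variable {D} in
theorem Tangent.vanishOn_vf {a : Fin d → SmoothFun (Fin d → ℝ)} (ha : D.Tangent a)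
    {f : SmoothFun (Fin d → ℝ)} (hf : D.VanishOn f) : D.VanishOn (vf a f) := by
  intro y hy
  obtain ⟨c, hc⟩ := D.exists_fderiv_eq_smul hf hy
  have h := ha y hy
  simp only [vf, AddSubmonoidClass.coe_finsetSum, Finset.sum_apply, MulMemClass.coe_mul,
    Pi.mul_apply, dir_apply] at h ⊢
  rw [hc]
  simp only [smul_apply, smul_eq_mul, mul_left_comm _ c, ← Finset.mul_sum]
  rw [h, mul_zero]

/-- Tangent vector fields that preserve the Dirichlet and the Neumann condition. -/
def Admissible (a : Fin d → SmoothFun (Fin d → ℝ)) : Prop :=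
  D.Tangent a ∧ ∀ v, D.BC v → D.BC (vf a v)

theorem admissible_of {a : Fin d → SmoothFun (Fin d → ℝ)} (ha : D.Tangent a)
    (h : ∀ v, D.VanishOn (vf D.nu v) → D.VanishOn (vf D.nu (vf a v))) : D.Admissible a :=
  ⟨ha, fun v hv => hv.imp ha.vanishOn_vf (h v)⟩

/-- The rotational fields `∂ᵢρ ∂ⱼ - ∂ⱼρ ∂ᵢ`. -/
def rot (i j : Fin d) : Fin d → SmoothFun (Fin d → ℝ) :=
  Pi.single j (D.nu i) - Pi.single i (D.nu j)

theorem vf_rot (i j : Fin d) (v : SmoothFun (Fin d → ℝ)) :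
    vf (D.rot i j) v = D.nu i * pder j v - D.nu j * pder i v := by
  rw [rot, vf_sub_coeff, vf_single, vf_single]

/-- The rotational fields, corrected so as to commute with the normal field on the boundary. -/
def rotAdm (i j : Fin d) : Fin d → SmoothFun (Fin d → ℝ) :=
  D.rot i j - (D.rho * D.invKap) • bracket D.nu (D.rot i j)

/-- The fields `ρ² ∂ₖ`. -/
def inner (k : Fin d) : Fin d → SmoothFun (Fin d → ℝ) := Pi.single k (D.rho ^ 2)

theorem vf_rotAdm (i j : Fin d) (v : SmoothFun (Fin d → ℝ)) :
    vf (D.rotAdm i j) v =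
      vf (D.rot i j) v - D.rho * (D.invKap * vf (bracket D.nu (D.rot i j)) v) := by
  rw [rotAdm, vf_sub_coeff, vf_smul_coeff, mul_assoc]

theorem admissible_rotAdm (i j : Fin d) : D.Admissible (D.rotAdm i j) := by
  have hrot : D.Tangent (D.rot i j) := by
    intro y _
    rw [D.vf_rot]
    simp [nu, mul_comm]
  refine D.admissible_of ?_ ?_
  · intro y hy
    rw [D.vf_rotAdm]
    have := hrot y hy
    simp [this, D.mem_frontier_iff.1 hy]
  · intro v hv y hy
    rw [D.vf_rotAdm, vf_sub, vf_comm, vf_mul, D.vf_nu_rho]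
    have h1 := hrot.vanishOn_vf hv y hy
    have h2 := D.invKap_mul_kap hy
    simp only [AddSubgroupClass.coe_sub, AddMemClass.coe_add, MulMemClass.coe_mul, Pi.sub_apply,
      Pi.add_apply, Pi.mul_apply, h1, D.mem_frontier_iff.1 hy]
    linear_combination -((vf (bracket D.nu (D.rot i j)) v : SmoothFun (Fin d → ℝ)) : _ → ℝ) y * h2

theorem admissible_inner (k : Fin d) : D.Admissible (D.inner k) := by
  refine D.admissible_of ?_ ?_
  · intro y hy
    rw [inner, vf_single]
    simp [D.mem_frontier_iff.1 hy]
  · intro v _ y hy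
    rw [inner, vf_single, sq, mul_assoc, vf_mul]
    simp [D.mem_frontier_iff.1 hy]

/-- A submodule that contains the Laplacian and the second derivatives tangential in one
variable contains all second derivatives times a power of `|∇ρ|`. -/
theorem kap_sq_mem {M : Submodule (SmoothFun (Fin d → ℝ))
    (SmoothFun (Fin d → ℝ) → SmoothFun (Fin d → ℝ))} (hlap : lap ∈ M)
    (hrot : ∀ i j k, (fun v => vf (D.rot i j) (pder k v)) ∈ M) (j k : Fin d) :
    (D.kap ^ 2 • fun v => pder j (pder k v)) ∈ M := by
  let R : Fin d → Fin d → SmoothFun (Fin d → ℝ) → SmoothFun (Fin d → ℝ) :=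
    fun j k v => ∑ i, D.nu i * vf (D.rot i j) (pder k v)
  have hR : ∀ j k, R j k ∈ M := fun j k =>
    sum_mul_mem _ D.nu (fun i v => vf (D.rot i j) (pder k v)) fun i _ => hrot i j k
  let n : Fin d → SmoothFun (Fin d → ℝ) → SmoothFun (Fin d → ℝ) :=
    fun k v => vf D.nu (pder k v)
  have h1 : ∀ j k v, D.kap * pder j (pder k v) = D.nu j * n k v + R j k v := by
    intro j k v
    simp only [n, R, vf_rot, kap, mul_sub, Finset.sum_sub_distrib, Finset.sum_mul]
    rw [vf, Finset.mul_sum, ← Finset.sum_sub_distrib, ← Finset.sum_add_distrib]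
    exact Finset.sum_congr rfl fun i _ => by ring
  let nn : SmoothFun (Fin d → ℝ) → SmoothFun (Fin d → ℝ) := fun v => ∑ k, D.nu k * n k v
  have hnn : nn ∈ M := by
    have : nn = D.kap • lap - ∑ j, R j j := by
      ext1 v
      simp only [nn, Pi.sub_apply, Pi.smul_apply, smul_eq_mul, Finset.sum_apply, lap,
        Finset.mul_sum, h1, Finset.sum_add_distrib]
      abel
    rw [this]
    exact M.sub_mem (M.smul_mem _ hlap) (M.sum_mem fun j _ => hR j j)
  have hn : ∀ k, D.kap • n k ∈ M := by
    intro k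
    have : D.kap • n k = D.nu k • nn + fun v => ∑ a, D.nu a * R k a v := by
      ext1 v
      simp only [Pi.smul_apply, Pi.add_apply, smul_eq_mul, nn]
      conv_lhs => simp only [n, vf]
      rw [Finset.mul_sum, Finset.mul_sum, ← Finset.sum_add_distrib]
      refine Finset.sum_congr rfl fun a _ => ?_
      rw [dir_comm, mul_left_comm, h1]
      ring
    rw [this]
    exact M.add_mem (M.smul_mem _ hnn) (sum_mul_mem _ _ _ fun a _ => hR k a)
  have : (D.kap ^ 2 • fun v => pder j (pder k v)) = D.nu j • (D.kap • n k) + D.kap • R j k := by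
    ext1 v
    simp only [Pi.smul_apply, Pi.add_apply, smul_eq_mul, sq, mul_assoc, h1]
    ring
  rw [this]
  exact M.add_mem (M.smul_mem _ (hn k)) (M.smul_mem _ (hR j k))

/-- The operators that lie in `M` after multiplication by `c`. -/
def colonSmul (M : Submodule (SmoothFun (Fin d → ℝ))
    (SmoothFun (Fin d → ℝ) → SmoothFun (Fin d → ℝ))) (c : SmoothFun (Fin d → ℝ)) :
    Submodule (SmoothFun (Fin d → ℝ)) (SmoothFun (Fin d → ℝ) → SmoothFun (Fin d → ℝ)) where
  carrier := {A | c • A ∈ M}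
  add_mem' {A B} hA hB := by
    rw [Set.mem_ofPred_eq, smul_add]
    exact M.add_mem hA hB
  zero_mem' := by
    rw [Set.mem_ofPred_eq, smul_zero]
    exact M.zero_mem
  smul_mem' b A hA := by
    rw [Set.mem_ofPred_eq, smul_smul, mul_comm, ← smul_smul]
    exact M.smul_mem b hA

theorem kap_sq_mem_of_rho {M : Submodule (SmoothFun (Fin d → ℝ))
    (SmoothFun (Fin d → ℝ) → SmoothFun (Fin d → ℝ))} (hlap : lap ∈ M)
    (hder : ∀ i, (fun v => pder i v) ∈ M)
    (hrot : ∀ i j k, (fun v => pder k (vf (D.rotAdm i j) v)) ∈ M)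
    (hrho : ∀ j k, (D.rho • fun v => pder j (pder k v)) ∈ M) (j k : Fin d) :
    (D.kap ^ 2 • fun v => pder j (pder k v)) ∈ M := by
  refine D.kap_sq_mem hlap (fun i j k => ?_) j k
  set b := bracket D.nu (D.rot i j) with hb
  have hsum : ∀ v, ∑ l, (D.invKap * b l) * (D.rho • fun v => pder l (pder k v)) v =
      D.rho * (D.invKap * vf b (pder k v)) := by
    intro v
    simp only [vf, Finset.mul_sum, Pi.smul_apply, smul_eq_mul]
    exact Finset.sum_congr rfl fun l _ => by ring
  have : (fun v => vf (D.rot i j) (pder k v)) =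
      (fun v => pder k (vf (D.rotAdm i j) v)) - vf (fun l => pder k (D.rotAdm i j l)) +
      fun v => ∑ l, (D.invKap * b l) * (D.rho • fun v => pder l (pder k v)) v := by
    ext1 v
    rw [Pi.add_apply, Pi.sub_apply, hsum, pder_vf, vf_rotAdm]
    abel
  rw [this]
  exact M.add_mem (M.sub_mem (hrot i j k) (sum_mul_mem _ _ _ fun i _ => hder i))
    (sum_mul_mem _ _ _ fun l _ => hrho l k)

theorem pder_pder_mem {M : Submodule (SmoothFun (Fin d → ℝ))
    (SmoothFun (Fin d → ℝ) → SmoothFun (Fin d → ℝ))} (hlap : lap ∈ M)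
    (hder : ∀ i, (fun v => pder i v) ∈ M)
    (hrot : ∀ i j k, (fun v => pder k (vf (D.rotAdm i j) v)) ∈ M)
    (hinn : ∀ j k, (fun v => pder k (vf (D.inner j) v)) ∈ M) (j k : Fin d) :
    (fun v => pder j (pder k v)) ∈ M := by
  have hin : ∀ j k, (D.rho ^ 2 • fun v => pder j (pder k v)) ∈ M := by
    intro j k
    have : (D.rho ^ 2 • fun v => pder j (pder k v)) = (fun v => pder j (vf (D.inner k) v)) -
        pder j (D.rho ^ 2) • fun v => pder k v := by
      ext1 v
      simp only [inner, vf_single, dir_mul, Pi.smul_apply, Pi.sub_apply, smul_eq_mul]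
      ring
    rw [this]
    exact M.sub_mem (hinn k j) (M.smul_mem _ (hder k))
  have step : ∀ c : SmoothFun (Fin d → ℝ),
      (∀ j k, (c • D.rho • fun v => pder j (pder k v)) ∈ M) →
      ∀ j k, (c • D.kap ^ 2 • fun v => pder j (pder k v)) ∈ M := fun c hc =>
    D.kap_sq_mem_of_rho (M := colonSmul M c) (M.smul_mem c hlap)
      (fun i => M.smul_mem c (hder i)) (fun i j k => M.smul_mem c (hrot i j k)) hc
  have h1 : ∀ j k, (D.rho • D.kap ^ 2 • fun v => pder j (pder k v)) ∈ M :=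
    step D.rho fun j k => by
      rw [smul_smul, ← sq]
      exact hin j k
  have h2 : ∀ j k, (D.kap ^ 2 • D.kap ^ 2 • fun v => pder j (pder k v)) ∈ M :=
    step (D.kap ^ 2) fun j k => by
      rw [smul_smul, mul_comm, ← smul_smul]
      exact h1 j k
  obtain ⟨g, hg⟩ := D.exists_inv_kap_pow_add
  have : (fun v => pder j (pder k v)) = g • ((D.kap ^ 2 • D.kap ^ 2 • fun v => pder j (pder k v)) +
      D.rho ^ 2 • fun v => pder j (pder k v)) := by
    rw [smul_smul, ← add_smul, smul_smul, ← pow_add, hg, one_smul]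
  rw [this]
  exact M.smul_mem _ (M.add_mem (h2 j k) (hin j k))

end SmoothDomain

namespace SmoothDomain

open SmoothFun

variable {d : ℕ} (D : SmoothDomain d)

/-- Integration over the domain. -/
def integ : SmoothFun (Fin d → ℝ) →ₗ[ℝ] ℝ where
  toFun f := ∫ y in D.carrier, (f : _ → ℝ) y
  map_add' f g := integral_add (D.integrableOn f.continuous) (D.integrableOn g.continuous)
  map_smul' c _ := integral_const_mul c _

theorem abs_integ_mul_le (f g : SmoothFun (Fin d → ℝ)) :
    |D.integ (f * g)| ≤ D.nrm f * D.nrm g := D.abs_integral_mul_le f g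

theorem integ_mul_self (f : SmoothFun (Fin d → ℝ)) : D.integ (f * f) = D.nrm f ^ 2 := by
  rw [D.nrm_sq]
  simp [integ, sq]

theorem integ_div (F : Fin d → SmoothFun (Fin d → ℝ)) (g : SmoothFun (Fin d → ℝ))
    (h : ∑ i, F i * pder i D.rho = g) (hg : D.VanishOn g) : D.integ (∑ i, pder i (F i)) = 0 :=
  D.integral_div_eq_zero F (h ▸ hg)

theorem sum_sq_nrm_pder {v : SmoothFun (Fin d → ℝ)} (hv : D.BC v) :
    ∑ i, D.nrm (pder i v) ^ 2 = -D.integ (v * lap v) := by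
  have h0 := D.integ_div (fun i => v * pder i v) (v * vf D.nu v)
    (by
      rw [vf, Finset.mul_sum]
      exact Finset.sum_congr rfl fun i _ => by rw [nu]; ring)
    (by
      intro y hy
      rcases hv with hv | hv <;> simp [hv y hy])
  have h1 : ∑ i, pder i (v * pder i v) = v * lap v + ∑ i, pder i v * pder i v := by
    rw [lap, Finset.mul_sum, ← Finset.sum_add_distrib]
    exact Finset.sum_congr rfl fun i _ => dir_mul _ _ _
  rw [h1, map_add, map_sum] at h0
  simp only [integ_mul_self] at h0
  linarith

theorem sob_one_le {v : SmoothFun (Fin d → ℝ)} (hv : D.BC v) :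
    D.sob 1 v ≤ D.nrm v + d * Real.sqrt |D.integ (v * lap v)| := by
  rw [sob_succ]
  have h : ∀ i ∈ Finset.univ, D.sob 0 (pder i v) ≤ Real.sqrt |D.integ (v * lap v)| := by
    intro i _
    refine Real.le_sqrt_of_sq_le ?_
    have h1 := Finset.single_le_sum (f := fun i => D.nrm (pder i v) ^ 2)
      (fun i _ => sq_nonneg _) (Finset.mem_univ i)
    have h2 := D.sum_sq_nrm_pder hv
    have h3 := neg_le_abs (D.integ (v * lap v))
    calc D.sob 0 (pder i v) ^ 2 = D.nrm (pder i v) ^ 2 := rfl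
      _ ≤ _ := by linarith
  have := Finset.sum_le_card_nsmul _ _ _ h
  rw [Finset.card_univ, Fintype.card_fin, nsmul_eq_mul] at this
  gcongr

theorem integ_mul_vf {a : Fin d → SmoothFun (Fin d → ℝ)} (ha : D.Tangent a)
    (w g : SmoothFun (Fin d → ℝ)) :
    D.integ (w * vf a g) = -D.integ (((∑ i, pder i (a i)) * w + vf a w) * g) := by
  have h0 := D.integ_div (fun i => a i * (w * g)) (w * g * vf a D.rho)
    (by
      rw [vf, Finset.mul_sum]
      exact Finset.sum_congr rfl fun i _ => by ring)
    (by
      intro y hy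
      have := ha y hy
      simp [this])
  have h1 : ∑ i, pder i (a i * (w * g)) =
      ((∑ i, pder i (a i)) * w + vf a w) * g + w * vf a g := by
    simp only [dir_mul, vf, add_mul, Finset.sum_mul, Finset.mul_sum, ← Finset.sum_add_distrib]
    exact Finset.sum_congr rfl fun i _ => by ring
  rw [h1, map_add] at h0
  linarith

theorem abs_integ_vf_mul_lap_le {a : Fin d → SmoothFun (Fin d → ℝ)} (ha : D.Tangent a) :
    ∃ K, 0 ≤ K ∧ ∀ v, |D.integ (vf a v * lap (vf a v))| ≤
      K * (D.sob 2 v * (D.nrm (lap v) + D.sob 1 v)) := by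
  obtain ⟨C₁, h₁, hC₁⟩ := D.exists_pos_of_mem_Dom (D.sob_nonneg _) (D.vf_mem_Dom 0 a)
  obtain ⟨C₂, h₂, hC₂⟩ := D.exists_pos_of_mem_Dom (D.sob_nonneg _) (D.vf_mem_Dom 1 a)
  obtain ⟨C₃, h₃, hC₃⟩ := D.exists_pos_of_mem_Dom (D.sob_nonneg _) (D.commLap_mem_Dom 0 a)
  obtain ⟨C₄, h₄, hC₄⟩ := D.sob_mul_le 0 (∑ i, pder i (a i))
  refine ⟨C₄ * C₁ + C₁ * C₂ + C₁ * C₃, by positivity, fun v => ?_⟩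
  have n0 := D.nrm_nonneg (lap v)
  have n1 := D.sob_nonneg 1 v
  have n2 := D.sob_nonneg 2 v
  have n12 := D.sob_le_succ 1 v
  rw [lap_vf, mul_add, map_add, D.integ_mul_vf ha]
  set w := vf a v with hw
  have hw0 : D.nrm w ≤ C₁ * D.sob 1 v := hC₁ v
  have e1 : D.nrm ((∑ i, pder i (a i)) * w + vf a w) ≤ (C₄ * C₁ + C₁ * C₂) * D.sob 2 v := by
    have : D.sob 0 (vf a w) ≤ C₁ * (C₂ * D.sob 2 v) :=
      (hC₁ w).trans (mul_le_mul_of_nonneg_left (hC₂ v) h₁)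
    have h' : D.sob 0 ((∑ i, pder i (a i)) * w) ≤ C₄ * (C₁ * D.sob 2 v) :=
      (hC₄ w).trans (mul_le_mul_of_nonneg_left (hw0.trans (by gcongr)) h₄)
    have := D.sob_add_le 0 ((∑ i, pder i (a i)) * w) (vf a w)
    calc _ ≤ _ := this
      _ ≤ _ := by linarith
  have e2 := D.abs_integ_mul_le ((∑ i, pder i (a i)) * w + vf a w) (lap v)
  have e3 := D.abs_integ_mul_le w (commLap a v)
  have e4 : D.nrm (commLap a v) ≤ C₃ * D.sob 2 v := hC₃ v
  calc _ ≤ D.nrm ((∑ i, pder i (a i)) * w + vf a w) * D.nrm (lap v) +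
        D.nrm w * D.nrm (commLap a v) := by
        refine (abs_add_le _ _).trans ?_
        rw [abs_neg]
        exact add_le_add e2 e3
    _ ≤ ((C₄ * C₁ + C₁ * C₂) * D.sob 2 v) * D.nrm (lap v) +
        (C₁ * D.sob 1 v) * (C₃ * D.sob 2 v) := by
        have := D.nrm_nonneg w
        have := D.nrm_nonneg (commLap a v)
        gcongr
    _ ≤ _ := by
        have p1 : 0 ≤ C₁ * C₃ * D.sob 2 v * D.nrm (lap v) := by positivity
        have p2 : 0 ≤ (C₄ * C₁ + C₁ * C₂) * D.sob 2 v * D.sob 1 v := by positivity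
        nlinarith

/-- The admissible fields `rotAdm` and `inner`, as one finite family. -/
def adm : (Fin d × Fin d) ⊕ Fin d → Fin d → SmoothFun (Fin d → ℝ)
  | Sum.inl p => D.rotAdm p.1 p.2
  | Sum.inr k => D.inner k

theorem admissible_adm (s : (Fin d × Fin d) ⊕ Fin d) : D.Admissible (D.adm s) :=
  match s with
  | Sum.inl p => D.admissible_rotAdm p.1 p.2
  | Sum.inr k => D.admissible_inner k

/-- The quantity that controls the derivatives of order `k + 2`. -/
def ctrl (k : ℕ) (v : SmoothFun (Fin d → ℝ)) : ℝ :=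
  D.sob k (lap v) + ∑ s, D.sob (k + 1) (vf (D.adm s) v) + D.sob (k + 1) v

theorem ctrl_nonneg (k : ℕ) (v : SmoothFun (Fin d → ℝ)) : 0 ≤ D.ctrl k v :=
  add_nonneg (add_nonneg (D.sob_nonneg _ _) (Finset.sum_nonneg fun _ _ => D.sob_nonneg _ _))
    (D.sob_nonneg _ _)

theorem sob_lap_le_ctrl (k : ℕ) (v : SmoothFun (Fin d → ℝ)) : D.sob k (lap v) ≤ D.ctrl k v := by
  have : 0 ≤ ∑ s, D.sob (k + 1) (vf (D.adm s) v) := Finset.sum_nonneg fun _ _ => D.sob_nonneg _ _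
  have := D.sob_nonneg (k + 1) v
  rw [ctrl]; linarith

theorem sob_le_ctrl (k : ℕ) (v : SmoothFun (Fin d → ℝ)) : D.sob (k + 1) v ≤ D.ctrl k v := by
  have : 0 ≤ ∑ s, D.sob (k + 1) (vf (D.adm s) v) := Finset.sum_nonneg fun _ _ => D.sob_nonneg _ _
  have := D.sob_nonneg k (lap v)
  rw [ctrl]; linarith

theorem sob_adm_le_ctrl (k : ℕ) (s) (v : SmoothFun (Fin d → ℝ)) :
    D.sob (k + 1) (vf (D.adm s) v) ≤ D.ctrl k v := by
  have := Finset.single_le_sum (f := fun s => D.sob (k + 1) (vf (D.adm s) v))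
    (fun _ _ => D.sob_nonneg _ _) (Finset.mem_univ s)
  have := D.sob_nonneg k (lap v)
  have := D.sob_nonneg (k + 1) v
  rw [ctrl]; linarith

theorem sob_add_two_le_ctrl (k : ℕ) : ∃ C, 0 ≤ C ∧ ∀ v, D.sob (k + 2) v ≤ C * D.ctrl k v := by
  have h : ∀ i j, (fun v => pder j (pder i v)) ∈ D.Dom k (D.ctrl k) := fun i j =>
    D.pder_pder_mem (D.mem_Dom_of_le (D.sob_lap_le_ctrl k))
      (fun i => D.mem_Dom_of_le fun v => (D.sob_pder_le k i v).trans (D.sob_le_ctrl k v))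
      (fun i j l => D.mem_Dom_of_le fun v => (D.sob_pder_le k l _).trans
        (D.sob_adm_le_ctrl k (Sum.inl (i, j)) v))
      (fun j l => D.mem_Dom_of_le fun v => (D.sob_pder_le k l _).trans
        (D.sob_adm_le_ctrl k (Sum.inr j) v)) j i
  choose C hC0 hC using fun i j => D.exists_pos_of_mem_Dom (D.ctrl_nonneg k) (h i j)
  refine ⟨1 + ∑ i, ∑ j, C i j, ?_, fun v => ?_⟩
  · exact add_nonneg zero_le_one
      (Finset.sum_nonneg fun i _ => Finset.sum_nonneg fun j _ => hC0 i j)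
  · have h1 : D.nrm v + ∑ i, D.nrm (pder i v) ≤ D.ctrl k v :=
      (D.sob_mono (Nat.le_add_left 1 k) v).trans (D.sob_le_ctrl k v)
    have h2 : ∑ i, ∑ j, D.sob k (pder j (pder i v)) ≤ (∑ i, ∑ j, C i j) * D.ctrl k v := by
      simp only [Finset.sum_mul]
      exact Finset.sum_le_sum fun i _ => Finset.sum_le_sum fun j _ => hC i j v
    simp only [sob_succ, Finset.sum_add_distrib]
    linarith

theorem sob_two_le : ∃ C, 0 ≤ C ∧ ∀ v, D.BC v →
    D.sob 2 v ≤ C * (D.nrm (lap v) + D.sob 1 v) := by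
  obtain ⟨A, hA0, hA⟩ := D.sob_add_two_le_ctrl 0
  choose B hB0 hB using fun s => D.exists_pos_of_mem_Dom (D.sob_nonneg _) (D.vf_mem_Dom 0 (D.adm s))
  choose K hK0 hK using fun s => D.abs_integ_vf_mul_lap_le (D.admissible_adm s).1
  have hKs : 0 ≤ ∑ s, Real.sqrt (K s) := Finset.sum_nonneg fun _ _ => Real.sqrt_nonneg _
  have hBs : 0 ≤ ∑ s, B s := Finset.sum_nonneg fun s _ => hB0 s
  set Q := A * (d * ∑ s, Real.sqrt (K s)) with hQ
  refine ⟨2 * (A * (1 + ∑ s, B s)) + Q ^ 2, by positivity, fun v hv => ?_⟩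
  set a := D.sob 2 v with ha
  set b := D.nrm (lap v) + D.sob 1 v with hb
  have na : 0 ≤ a := D.sob_nonneg 2 v
  have n1 : 0 ≤ D.sob 1 v := D.sob_nonneg 1 v
  have nb : 0 ≤ b := add_nonneg (D.nrm_nonneg _) n1
  have h1 : ∀ s, D.sob 1 (vf (D.adm s) v) ≤
      B s * b + d * (Real.sqrt (K s) * Real.sqrt (a * b)) := by
    intro s
    refine (D.sob_one_le ((D.admissible_adm s).2 v hv)).trans (add_le_add ?_ ?_)
    · refine (hB s v).trans (mul_le_mul_of_nonneg_left ?_ (hB0 s))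
      linarith [D.nrm_nonneg (lap v)]
    · rw [← Real.sqrt_mul (hK0 s)]
      gcongr
      exact hK s v
  have h2 : ∑ s, D.sob 1 (vf (D.adm s) v) ≤
      (∑ s, B s) * b + (d * ∑ s, Real.sqrt (K s)) * Real.sqrt (a * b) := by
    simp only [Finset.sum_mul, Finset.mul_sum]
    rw [← Finset.sum_add_distrib]
    exact Finset.sum_le_sum fun s _ => (h1 s).trans_eq (by ring)
  have h3 : a ≤ A * (b + ((∑ s, B s) * b + (d * ∑ s, Real.sqrt (K s)) * Real.sqrt (a * b))) := by
    refine (hA v).trans (mul_le_mul_of_nonneg_left ?_ hA0)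
    have : D.ctrl 0 v = b + ∑ s, D.sob 1 (vf (D.adm s) v) := by
      rw [ctrl, hb]
      change D.nrm (lap v) + ∑ s, D.sob 1 (vf (D.adm s) v) + D.sob 1 v = _
      ring
    linarith
  have h4 : Q * Real.sqrt (a * b) ≤ a / 2 + Q ^ 2 * b / 2 := by
    rw [Real.sqrt_mul na]
    have e1 := Real.sq_sqrt na
    have e2 := Real.sq_sqrt nb
    nlinarith [sq_nonneg (Real.sqrt a - Q * Real.sqrt b)]
  have h5 : a ≤ A * (1 + ∑ s, B s) * b + Q * Real.sqrt (a * b) := h3.trans_eq (by rw [hQ]; ring)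
  linarith

theorem lap_sob_le (k : ℕ) (a : Fin d → SmoothFun (Fin d → ℝ)) : ∃ C, 0 ≤ C ∧ ∀ v,
    D.sob k (lap (vf a v)) ≤ C * (D.sob (k + 1) (lap v) + D.sob (k + 2) v) := by
  obtain ⟨C₁, h₁, hC₁⟩ := D.exists_pos_of_mem_Dom (D.sob_nonneg _) (D.vf_mem_Dom k a)
  obtain ⟨C₂, h₂, hC₂⟩ := D.exists_pos_of_mem_Dom (D.sob_nonneg _) (D.commLap_mem_Dom k a)
  refine ⟨C₁ + C₂, by positivity, fun v => ?_⟩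
  rw [lap_vf]
  refine (D.sob_add_le k _ _).trans ((add_le_add (hC₁ _) (hC₂ v)).trans ?_)
  have p1 := mul_nonneg h₁ (D.sob_nonneg (k + 2) v)
  have p2 := mul_nonneg h₂ (D.sob_nonneg (k + 1) (lap v))
  linarith

theorem sob_add_two_le_succ (k : ℕ) : ∃ C, 0 ≤ C ∧ ∀ v, D.BC v →
    D.sob (k + 2) v ≤ C * (D.sob k (lap v) + D.sob (k + 1) v) := by
  induction k with
  | zero => exact D.sob_two_le
  | succ k ih =>
    obtain ⟨E, hE0, hE⟩ := ih
    obtain ⟨A, hA0, hA⟩ := D.sob_add_two_le_ctrl (k + 1)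
    choose B hB0 hB using fun s => D.lap_sob_le k (D.adm s)
    choose P hP0 hP using fun s =>
      D.exists_pos_of_mem_Dom (D.sob_nonneg _) (D.vf_mem_Dom (k + 1) (D.adm s))
    refine ⟨A * (1 + ∑ s, E * (B s + P s)), mul_nonneg hA0 (add_nonneg zero_le_one
      (Finset.sum_nonneg fun s _ => mul_nonneg hE0 (add_nonneg (hB0 s) (hP0 s)))), fun v hv => ?_⟩
    set b := D.sob (k + 1) (lap v) + D.sob (k + 1 + 1) v with hb
    have h1 : ∀ s, D.sob (k + 1 + 1) (vf (D.adm s) v) ≤ E * (B s + P s) * b := by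
      intro s
      refine (hE _ ((D.admissible_adm s).2 v hv)).trans ?_
      rw [mul_assoc]
      refine mul_le_mul_of_nonneg_left ?_ hE0
      rw [add_mul]
      refine add_le_add (hB s v) ((hP s v).trans (mul_le_mul_of_nonneg_left ?_ (hP0 s)))
      exact le_add_of_nonneg_left (D.sob_nonneg _ _)
    refine (hA v).trans ?_
    rw [mul_assoc]
    refine mul_le_mul_of_nonneg_left ?_ hA0
    have := Finset.sum_le_sum fun s (_ : s ∈ Finset.univ) => h1 s
    rw [← Finset.sum_mul] at this
    rw [ctrl]
    linarith

theorem sob_one_le_lap : ∃ C, 0 ≤ C ∧ ∀ v, D.BC v →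
    D.sob 1 v ≤ C * (D.nrm (lap v) + D.nrm v) := by
  refine ⟨1 + d, by positivity, fun v hv => (D.sob_one_le hv).trans ?_⟩
  have n0 := D.nrm_nonneg (lap v)
  have n1 := D.nrm_nonneg v
  have : Real.sqrt |D.integ (v * lap v)| ≤ D.nrm (lap v) + D.nrm v := by
    rw [Real.sqrt_le_left (by positivity)]
    refine (D.abs_integ_mul_le _ _).trans ?_
    nlinarith
  have := mul_le_mul_of_nonneg_left this (Nat.cast_nonneg (α := ℝ) d)
  linarith

/-- Elliptic regularity for the Dirichlet and the Neumann problem. -/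
theorem sob_add_two_le (k : ℕ) : ∃ C, 0 ≤ C ∧ ∀ v, D.BC v →
    D.sob (k + 2) v ≤ C * (D.sob k (lap v) + D.nrm v) := by
  have aux : ∀ k l, l ≤ k → (∃ C, 0 ≤ C ∧ ∀ v, D.BC v →
      D.sob (k + 1) v ≤ C * (D.sob l (lap v) + D.nrm v)) → ∃ C, 0 ≤ C ∧ ∀ v, D.BC v →
      D.sob (k + 2) v ≤ C * (D.sob k (lap v) + D.nrm v) := by
    rintro k l hl ⟨C, hC0, hC⟩
    obtain ⟨E, hE0, hE⟩ := D.sob_add_two_le_succ k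
    refine ⟨E * (1 + C), by positivity, fun v hv => (hE v hv).trans ?_⟩
    rw [mul_assoc]
    refine mul_le_mul_of_nonneg_left ?_ hE0
    have h1 := hC v hv
    have h2 := mul_le_mul_of_nonneg_left (D.sob_mono hl (lap v)) hC0
    have := D.nrm_nonneg v
    linarith
  induction k with
  | zero => exact aux 0 0 le_rfl D.sob_one_le_lap
  | succ k ih => exact aux (k + 1) k (Nat.le_succ k) ih

end SmoothDomain

namespace SmoothDomain

open SmoothFun

variable {d : ℕ} (D : SmoothDomain d)

/-- The truncated cone with vertex `y` over `K` is contained in the domain. -/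
def HasCone (K : Set (Fin d → ℝ)) (y : Fin d → ℝ) : Prop :=
  ∀ s : ℝ, 0 < s → s ≤ 1 → ∀ e ∈ K, y + s • e ∈ D.carrier

theorem exists_cone_of_carrier {y₀ : Fin d → ℝ} (hy₀ : y₀ ∈ D.carrier) :
    ∃ (e₀ : Fin d → ℝ) (r : ℝ), 0 < r ∧
      ∀ᶠ y in nhds y₀, D.HasCone (Metric.closedBall e₀ r) y := by
  obtain ⟨δ, hδ, hball⟩ := Metric.isOpen_iff.1 D.isOpen y₀ hy₀
  refine ⟨0, δ / 2, half_pos hδ, ?_⟩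
  filter_upwards [Metric.ball_mem_nhds y₀ (half_pos hδ)] with y hy s hs0 hs1 e he
  apply hball
  rw [Metric.mem_ball, dist_eq_norm] at hy ⊢
  rw [mem_closedBall_zero_iff] at he
  calc ‖y + s • e - y₀‖ = ‖(y - y₀) + s • e‖ := by congr 1; abel
    _ ≤ ‖y - y₀‖ + ‖s • e‖ := norm_add_le _ _
    _ ≤ ‖y - y₀‖ + 1 * ‖e‖ := by
        rw [norm_smul, Real.norm_of_nonneg hs0.le]
        gcongr
    _ < δ := by linarith

theorem exists_cone_of_frontier {y₀ : Fin d → ℝ} (hy₀ : y₀ ∈ frontier D.carrier) :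
    ∃ (e₀ : Fin d → ℝ) (r : ℝ), 0 < r ∧
      ∀ᶠ y in nhds y₀, y ∈ closure D.carrier → D.HasCone (Metric.closedBall e₀ r) y := by
  obtain ⟨e₁, he₁⟩ : ∃ e, fderiv ℝ (D.rho : _ → ℝ) y₀ e < 0 := by
    by_contra! h
    refine D.fderiv_rho_ne hy₀ (ContinuousLinearMap.ext fun e => le_antisymm ?_ (h e))
    have := h (-e)
    rw [map_neg] at this
    simpa using this
  have hcont : Continuous fun p : (Fin d → ℝ) × (Fin d → ℝ) =>
      fderiv ℝ (D.rho : _ → ℝ) p.1 p.2 :=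
    (D.rho.continuous_fderiv.comp continuous_fst).clm_apply continuous_snd
  obtain ⟨δ, hδ, hneg⟩ := Metric.eventually_nhds_iff.1
    (hcont.continuousAt.eventually_lt (continuousAt_const (y := (0 : ℝ))) he₁ :
      ∀ᶠ p in nhds (y₀, e₁), fderiv ℝ (D.rho : _ → ℝ) p.1 p.2 < 0)
  have hden : 0 < ‖e₁‖ + δ := by positivity
  set t := δ / 2 / (‖e₁‖ + δ) with ht
  have ht0 : 0 < t := by positivity
  have htm : t * (‖e₁‖ + δ) = δ / 2 := by rw [ht]; field_simp
  refine ⟨t • e₁, t * (δ / 2), by positivity, ?_⟩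
  filter_upwards [Metric.ball_mem_nhds y₀ (half_pos hδ)] with y hy hyc s hs0 hs1 e he
  rw [Metric.mem_ball, dist_eq_norm] at hy
  rw [Metric.mem_closedBall, dist_eq_norm] at he
  have he' : ‖t⁻¹ • e - e₁‖ < δ := by
    have : t⁻¹ • e - e₁ = t⁻¹ • (e - t • e₁) := by
      rw [smul_sub, smul_smul, inv_mul_cancel₀ ht0.ne', one_smul]
    rw [this, norm_smul, norm_inv, Real.norm_of_nonneg ht0.le]
    calc t⁻¹ * ‖e - t • e₁‖ ≤ t⁻¹ * (t * (δ / 2)) := by gcongr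
      _ = δ / 2 := by field_simp
      _ < δ := half_lt_self hδ
  have hen : ‖e‖ ≤ δ / 2 := by
    calc ‖e‖ = ‖(e - t • e₁) + t • e₁‖ := by congr 1; abel
      _ ≤ t * (δ / 2) + t * ‖e₁‖ := by
        refine (norm_add_le _ _).trans (add_le_add he ?_)
        rw [norm_smul, Real.norm_of_nonneg ht0.le]
      _ ≤ δ / 2 := by rw [← htm]; nlinarith
  have hder : ∀ τ : ℝ, HasDerivAt (fun τ : ℝ => (D.rho : _ → ℝ) (y + τ • e))
      (fderiv ℝ (D.rho : _ → ℝ) (y + τ • e) e) τ := by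
    intro τ
    have h2 : HasDerivAt (fun τ : ℝ => y + τ • e) e τ := by
      simpa using ((hasDerivAt_id τ).smul_const e).const_add y
    exact (D.rho.differentiable _).hasFDerivAt.comp_hasDerivAt τ h2
  have hanti : StrictAntiOn (fun τ : ℝ => (D.rho : _ → ℝ) (y + τ • e)) (Set.Icc 0 s) := by
    refine strictAntiOn_of_deriv_neg (convex_Icc 0 s)
      (fun τ _ => (hder τ).continuousAt.continuousWithinAt) fun τ hτ => ?_
    rw [interior_Icc] at hτ
    rw [(hder τ).deriv]
    have hlt : fderiv ℝ (D.rho : _ → ℝ) (y + τ • e) (t⁻¹ • e) < 0 := by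
      refine hneg (y := (y + τ • e, t⁻¹ • e)) ?_
      rw [Prod.dist_eq, max_lt_iff, dist_eq_norm, dist_eq_norm]
      refine ⟨?_, he'⟩
      calc ‖y + τ • e - y₀‖ = ‖(y - y₀) + τ • e‖ := by congr 1; abel
        _ ≤ ‖y - y₀‖ + ‖τ • e‖ := norm_add_le _ _
        _ ≤ ‖y - y₀‖ + 1 * ‖e‖ := by
          rw [norm_smul, Real.norm_of_nonneg hτ.1.le]
          gcongr
          exact hτ.2.le.trans hs1
        _ < δ := by linarith
    rw [map_smul, smul_eq_mul] at hlt
    exact neg_of_mul_neg_left (by linarith) (inv_pos.2 ht0).le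
  have := hanti (Set.left_mem_Icc.2 hs0.le) (Set.right_mem_Icc.2 hs0.le) hs0
  rw [D.mem_carrier_iff]
  have h0 := D.rho_nonpos hyc
  simp only [zero_smul, add_zero] at this
  linarith

/-- The mean of `|f|` over the dilate `y + sK`, up to normalization. -/
def coneMean (K : Set (Fin d → ℝ)) (y : Fin d → ℝ) (f : SmoothFun (Fin d → ℝ)) (s : ℝ) : ℝ :=
  ∫ e in K, |(f : _ → ℝ) (y + s • e)|

variable {K : Set (Fin d → ℝ)}

theorem continuous_cone (y : Fin d → ℝ) (f : SmoothFun (Fin d → ℝ)) :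
    Continuous fun p : ℝ × (Fin d → ℝ) => (f : _ → ℝ) (y + p.1 • p.2) :=
  f.continuous.comp (by fun_prop)

theorem continuous_coneMean (hK : IsCompact K) (y : Fin d → ℝ) (f : SmoothFun (Fin d → ℝ)) :
    Continuous (coneMean K y f) :=
  continuous_parametric_integral_of_continuous (continuous_cone y f).abs hK

theorem continuous_slice (y : Fin d → ℝ) (f : SmoothFun (Fin d → ℝ)) (s : ℝ) :
    Continuous fun e : Fin d → ℝ => (f : _ → ℝ) (y + s • e) :=
  f.continuous.comp (by fun_prop)

theorem sq_integral_le {g : (Fin d → ℝ) → ℝ} (hg : Continuous g) (hK : IsCompact K) :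
    (∫ e in K, |g e|) ^ 2 ≤ volume.real K * ∫ e in K, g e ^ 2 := by
  have hi : ∀ {h : (Fin d → ℝ) → ℝ}, Continuous h → IntegrableOn h K := fun h =>
    h.continuousOn.integrableOn_compact hK
  set V := volume.real K
  set M := ∫ e in K, |g e| with hM
  have key : ∀ c : ℝ, 0 ≤ (∫ e in K, g e ^ 2) - 2 * c * M + c ^ 2 * V := by
    intro c
    have h1 : 0 ≤ ∫ e in K, (|g e| - c) ^ 2 := integral_nonneg fun _ => sq_nonneg _
    have h2 : ∫ e in K, (|g e| - c) ^ 2 = ∫ e in K, (g e ^ 2 - 2 * c * |g e| + c ^ 2) := by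
      congr 1
      ext e
      rw [sub_sq, sq_abs]
      ring
    rw [h2, integral_add, integral_sub, integral_const_mul, setIntegral_const, smul_eq_mul,
      mul_comm _ (c ^ 2)] at h1
    · exact h1
    · exact hi (hg.pow 2)
    · exact hi (continuous_const.mul hg.abs)
    · exact hi ((hg.pow 2).sub (continuous_const.mul hg.abs))
    · exact hi continuous_const
  have hV : 0 ≤ V := measureReal_nonneg
  rcases hV.eq_or_lt with hV0 | hV0
  · have h0 := key ((∫ e in K, g e ^ 2) + 1)
    have hI : 0 ≤ ∫ e in K, g e ^ 2 := integral_nonneg fun _ => sq_nonneg _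
    have hM0 : 0 ≤ M := integral_nonneg fun _ => abs_nonneg _
    have h3 : M = 0 := by
      have hz : volume K = 0 := by
        rcases (measureReal_eq_zero_iff hK.measure_lt_top.ne).1 hV0.symm with h
        exact h
      rw [hM, Measure.restrict_eq_zero.2 hz, integral_zero_measure]
    rw [← hV0, h3]
    simp
  · have h0 := key (M / V)
    have : (∫ e in K, g e ^ 2) - 2 * (M / V) * M + (M / V) ^ 2 * V =
        (∫ e in K, g e ^ 2) - M ^ 2 / V := by
      field_simp
      ring
    rw [this, sub_nonneg, div_le_iff₀ hV0] at h0
    linarith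

theorem integral_cone_sq_le {y : Fin d → ℝ} (hy : D.HasCone K y)
    (f : SmoothFun (Fin d → ℝ)) {s : ℝ} (hs0 : 0 < s) (hs1 : s ≤ 1) :
    ∫ e in K, ((f : _ → ℝ) (y + s • e)) ^ 2 ≤ (s ^ d)⁻¹ * D.nrm f ^ 2 := by
  have h1 := Measure.setIntegral_comp_smul_of_pos (volume : Measure (Fin d → ℝ))
    (fun x => ((f : _ → ℝ) (y + x)) ^ 2) K hs0
  rw [h1, Module.finrank_fin_fun, smul_eq_mul]
  refine mul_le_mul_of_nonneg_left ?_ (by positivity)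
  rw [D.nrm_sq, ← (measurePreserving_add_left volume y).setIntegral_image_emb
    (measurableEmbedding_addLeft y) (fun x => ((f : _ → ℝ) x) ^ 2)]
  refine setIntegral_mono_set (D.integrableOn (f.continuous.pow 2))
    (Filter.Eventually.of_forall fun _ => sq_nonneg _) (Filter.Eventually.of_forall ?_)
  rintro _ ⟨_, ⟨e, he, rfl⟩, rfl⟩
  exact hy s hs0 hs1 e he

theorem coneMean_le_nrm (hK : IsCompact K) {y : Fin d → ℝ} (hy : D.HasCone K y)
    (f : SmoothFun (Fin d → ℝ)) {s : ℝ} (hs0 : 0 < s) (hs1 : s ≤ 1) {p : ℝ} (hp : d ≤ 2 * p) :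
    coneMean K y f s ≤ Real.sqrt (volume.real K) * s ^ (-p) * D.nrm f := by
  have hV : 0 ≤ volume.real K := measureReal_nonneg
  refine abs_le_of_sq_le_sq' ?_ (mul_nonneg (mul_nonneg (Real.sqrt_nonneg _)
    (Real.rpow_nonneg hs0.le _)) (D.nrm_nonneg f)) |>.2
  refine (sq_integral_le (continuous_slice y f s) hK).trans ?_
  rw [mul_pow, mul_pow, Real.sq_sqrt hV, mul_assoc]
  refine mul_le_mul_of_nonneg_left ?_ hV
  refine (D.integral_cone_sq_le hy f hs0 hs1).trans ?_
  refine mul_le_mul_of_nonneg_right ?_ (sq_nonneg _)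
  rw [← Real.rpow_natCast, ← Real.rpow_neg hs0.le, ← Real.rpow_natCast, ← Real.rpow_mul hs0.le]
  refine Real.rpow_le_rpow_of_exponent_ge hs0 hs1 ?_
  push_cast
  linarith

theorem abs_le_along_ray {R : ℝ} {e : Fin d → ℝ} (he : ‖e‖ ≤ R) (y : Fin d → ℝ)
    (f : SmoothFun (Fin d → ℝ)) {s : ℝ} (hs1 : s ≤ 1) :
    |(f : _ → ℝ) (y + s • e)| ≤ |(f : _ → ℝ) (y + (1 : ℝ) • e)| +
      R * ∑ i, ∫ τ in s..1, |(pder i f : _ → ℝ) (y + τ • e)| := by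
  have hc : ∀ i, Continuous fun τ : ℝ => (pder i f : _ → ℝ) (y + τ • e) := fun i =>
    (continuous_cone y (pder i f)).comp (continuous_id.prodMk continuous_const)
  have hlin : ∀ x, fderiv ℝ (f : _ → ℝ) x e = ∑ i, e i * (pder i f : _ → ℝ) x := by
    intro x
    conv_lhs => rw [pi_eq_sum_univ' e]
    simp [map_sum]
  have hder : ∀ τ : ℝ, HasDerivAt (fun τ : ℝ => (f : _ → ℝ) (y + τ • e))
      (∑ i, e i * (pder i f : _ → ℝ) (y + τ • e)) τ := by
    intro τ
    have h2 : HasDerivAt (fun τ : ℝ => y + τ • e) e τ := by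
      simpa using ((hasDerivAt_id τ).smul_const e).const_add y
    rw [← hlin]
    exact (f.differentiable _).hasFDerivAt.comp_hasDerivAt τ h2
  have hsum : Continuous fun τ : ℝ => ∑ i, e i * (pder i f : _ → ℝ) (y + τ • e) :=
    continuous_finsetSum _ fun i _ => continuous_const.mul (hc i)
  have hint := intervalIntegral.integral_eq_sub_of_hasDerivAt (a := s) (b := 1)
    (fun τ _ => hder τ) (hsum.intervalIntegrable _ _)
  have hcR : ∀ i, IntervalIntegrable (fun τ : ℝ => R * |(pder i f : _ → ℝ) (y + τ • e)|)
      volume s 1 := fun i => (continuous_const.mul (hc i).abs).intervalIntegrable _ _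
  have hcsum : Continuous fun τ : ℝ => ∑ i, R * |(pder i f : _ → ℝ) (y + τ • e)| :=
    continuous_finsetSum _ fun i _ => continuous_const.mul (hc i).abs
  have hbd : |∫ τ in s..1, ∑ i, e i * (pder i f : _ → ℝ) (y + τ • e)| ≤
      ∫ τ in s..1, ∑ i, R * |(pder i f : _ → ℝ) (y + τ • e)| := by
    rw [← Real.norm_eq_abs]
    refine intervalIntegral.norm_integral_le_of_norm_le hs1 (Filter.Eventually.of_forall ?_)
      (hcsum.intervalIntegrable _ _)
    intro τ _
    refine (norm_sum_le _ _).trans (Finset.sum_le_sum fun i _ => ?_)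
    rw [norm_mul]
    exact mul_le_mul_of_nonneg_right ((norm_le_pi_norm e i).trans he) (norm_nonneg _)
  rw [intervalIntegral.integral_finsetSum fun i _ => hcR i] at hbd
  simp only [intervalIntegral.integral_const_mul, ← Finset.mul_sum] at hbd
  rw [hint] at hbd
  have := abs_sub_abs_le_abs_sub ((f : _ → ℝ) (y + s • e)) ((f : _ → ℝ) (y + (1 : ℝ) • e))
  rw [abs_sub_comm] at this
  linarith

theorem coneMean_le_add {R : ℝ} (hK : IsCompact K) (hR : ∀ e ∈ K, ‖e‖ ≤ R) (y : Fin d → ℝ)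
    (f : SmoothFun (Fin d → ℝ)) {s : ℝ} (hs1 : s ≤ 1) :
    coneMean K y f s ≤ coneMean K y f 1 +
      R * ∑ i, ∫ τ in s..1, coneMean K y (pder i f) τ := by
  have hcont : ∀ i, Continuous fun e : Fin d → ℝ =>
      ∫ τ in s..1, |(pder i f : _ → ℝ) (y + τ • e)| := fun i =>
    intervalIntegral.continuous_parametric_intervalIntegral_of_continuous'
      (f := fun e τ => |(pder i f : _ → ℝ) (y + τ • e)|)
      (((continuous_cone y (pder i f)).comp continuous_swap).abs) s 1
  have hi : ∀ {h : (Fin d → ℝ) → ℝ}, Continuous h → IntegrableOn h K := fun h =>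
    h.continuousOn.integrableOn_compact hK
  have hswap : ∀ i, ∫ τ in s..1, coneMean K y (pder i f) τ =
      ∫ e in K, ∫ τ in s..1, |(pder i f : _ → ℝ) (y + τ • e)| := by
    intro i
    refine intervalIntegral_integral_swap (μ := volume.restrict K)
      (f := fun τ e => |(pder i f : _ → ℝ) (y + τ • e)|) ?_
    rw [Measure.prod_restrict]
    refine IntegrableOn.mono_set ?_ (Set.prod_mono (Set.uIoc_subset_uIcc (a := s) (b := 1)) le_rfl)
    exact (continuous_cone y (pder i f)).abs.continuousOn.integrableOn_compact
      (isCompact_uIcc.prod hK)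
  have hcs : Continuous fun e : Fin d → ℝ =>
      R * ∑ i, ∫ τ in s..1, |(pder i f : _ → ℝ) (y + τ • e)| :=
    continuous_const.mul (continuous_finsetSum _ fun i _ => hcont i)
  simp only [hswap]
  rw [← integral_finsetSum _ fun i _ => hi (hcont i), ← integral_const_mul]
  simp only [coneMean]
  rw [← integral_add (hi (continuous_slice y f 1).abs) (hi hcs)]
  exact setIntegral_mono_on (hi (continuous_slice y f s).abs)
    (hi ((continuous_slice y f 1).abs.add hcs)) hK.measurableSet
    fun e he => abs_le_along_ray (hR e he) y f hs1

/-- One step of the bootstrap: bounds for the first derivatives improve the growth exponent. -/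
theorem coneMean_le_step {R C : ℝ} (hK : IsCompact K) (hR : ∀ e ∈ K, ‖e‖ ≤ R) (hR0 : 0 ≤ R)
    {j : ℕ} {p B : ℝ} {y : Fin d → ℝ} (hC0 : 0 ≤ C)
    (hC : ∀ (f : SmoothFun (Fin d → ℝ)) (s : ℝ), 0 < s → s ≤ 1 →
      coneMean K y f s ≤ C * s ^ (-p) * D.sob j f)
    (f : SmoothFun (Fin d → ℝ)) {s : ℝ} (hs0 : 0 < s) (hs1 : s ≤ 1) (hB1 : 1 ≤ B)
    (hB : ∫ τ in s..1, τ ^ (-p) ≤ 2 * B) :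
    coneMean K y f s ≤ C * (1 + R * 2) * B * D.sob (j + 1) f := by
  have h1 : coneMean K y f 1 ≤ C * D.sob (j + 1) f := by
    have := hC f 1 one_pos le_rfl
    rw [Real.one_rpow, mul_one] at this
    exact this.trans (mul_le_mul_of_nonneg_left (D.sob_le_succ j f) hC0)
  have hii : IntervalIntegrable (fun τ : ℝ => τ ^ (-p)) volume s 1 := by
    refine intervalIntegral.intervalIntegrable_rpow (Or.inr ?_)
    rw [Set.uIcc_of_le hs1]
    exact fun h => absurd h.1 (not_le.2 hs0)
  have h2 : ∀ i, ∫ τ in s..1, coneMean K y (pder i f) τ ≤ C * (2 * B) * D.sob j (pder i f) := by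
    intro i
    calc ∫ τ in s..1, coneMean K y (pder i f) τ
        ≤ ∫ τ in s..1, C * D.sob j (pder i f) * τ ^ (-p) := by
          refine intervalIntegral.integral_mono_on hs1
            ((continuous_coneMean hK y _).intervalIntegrable _ _) (hii.const_mul _) ?_
          intro τ hτ
          exact (hC _ τ (hs0.trans_le hτ.1) hτ.2).trans_eq (by ring)
      _ = C * D.sob j (pder i f) * ∫ τ in s..1, τ ^ (-p) := intervalIntegral.integral_const_mul _ _
      _ ≤ C * D.sob j (pder i f) * (2 * B) :=
          mul_le_mul_of_nonneg_left hB (mul_nonneg hC0 (D.sob_nonneg _ _))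
      _ = _ := by ring
  have h3 : ∑ i, ∫ τ in s..1, coneMean K y (pder i f) τ ≤ C * (2 * B) * D.sob (j + 1) f := by
    refine (Finset.sum_le_sum fun i _ => h2 i).trans ?_
    rw [← Finset.mul_sum, sob_succ]
    refine mul_le_mul_of_nonneg_left (le_add_of_nonneg_left (D.nrm_nonneg f)) ?_
    positivity
  refine (coneMean_le_add hK hR y f hs1).trans ((add_le_add h1
    (mul_le_mul_of_nonneg_left h3 hR0)).trans ?_)
  have := mul_le_mul_of_nonneg_left hB1 (mul_nonneg hC0 (D.sob_nonneg (j + 1) f))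
  linarith

theorem coneMean_le_rpow {R : ℝ} (hK : IsCompact K) (hR : ∀ e ∈ K, ‖e‖ ≤ R) (hR0 : 0 ≤ R)
    (j n : ℕ) (hn : d / 2 ≤ n + j) : ∃ C, 0 ≤ C ∧ ∀ y, D.HasCone K y →
      ∀ (f : SmoothFun (Fin d → ℝ)) (s : ℝ), 0 < s → s ≤ 1 →
        coneMean K y f s ≤ C * s ^ (-(n + 1 / 2 : ℝ)) * D.sob j f := by
  induction j generalizing n with
  | zero =>
    refine ⟨Real.sqrt (volume.real K), Real.sqrt_nonneg _, fun y hy f s hs0 hs1 =>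
      D.coneMean_le_nrm hK hy f hs0 hs1 ?_⟩
    have : d ≤ 2 * n + 1 := by omega
    have : (d : ℝ) ≤ 2 * n + 1 := by exact_mod_cast this
    linarith
  | succ j ih =>
    obtain ⟨C, hC0, hC⟩ := ih (n + 1) (by omega)
    refine ⟨C * (1 + R * 2), by positivity, fun y hy f s hs0 hs1 =>
      D.coneMean_le_step hK hR hR0 hC0 (hC y hy) f hs0 hs1 ?_ ?_⟩
    · exact Real.one_le_rpow_of_pos_of_le_one_of_nonpos hs0 hs1 (by
        have : (0 : ℝ) ≤ n := Nat.cast_nonneg n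
        linarith)
    · have hn0 : (0 : ℝ) ≤ n := Nat.cast_nonneg n
      have h0 : (0 : ℝ) ∉ Set.uIcc s 1 := by
        rw [Set.uIcc_of_le hs1]
        exact fun h => absurd h.1 (not_le.2 hs0)
      rw [integral_rpow (Or.inr ⟨by push_cast; linarith, h0⟩), Real.one_rpow]
      have he : -((↑(n + 1) : ℝ) + 1 / 2) + 1 = -(n + 1 / 2 : ℝ) := by push_cast; ring
      rw [he]
      have hpos : (0 : ℝ) ≤ s ^ (-(n + 1 / 2 : ℝ)) := Real.rpow_nonneg hs0.le _
      rw [div_le_iff_of_neg (by linarith)]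
      nlinarith [mul_nonneg hn0 hpos]

theorem abs_le_sob_of_cone (hK : IsCompact K) (hV : 0 < volume.real K) :
    ∃ C, 0 ≤ C ∧ ∀ y, D.HasCone K y → ∀ f : SmoothFun (Fin d → ℝ),
      |(f : _ → ℝ) y| ≤ C * D.sob (d / 2 + 1) f := by
  obtain ⟨R, hR⟩ := hK.isBounded.exists_norm_le
  have hR' : ∀ e ∈ K, ‖e‖ ≤ max R 0 := fun e he => (hR e he).trans (le_max_left _ _)
  have hR0 : 0 ≤ max R 0 := le_max_right _ _
  obtain ⟨C, hC0, hC⟩ := D.coneMean_le_rpow hK hR' hR0 (d / 2) 0 (by omega)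
  refine ⟨(volume.real K)⁻¹ * (C * (1 + max R 0 * 2)), by positivity, fun y hy f => ?_⟩
  have hle : ∀ s : ℝ, 0 < s → s ≤ 1 →
      coneMean K y f s ≤ C * (1 + max R 0 * 2) * 1 * D.sob (d / 2 + 1) f := by
    intro s hs0 hs1
    refine D.coneMean_le_step hK hR' hR0 hC0 (hC y hy) f hs0 hs1 le_rfl ?_
    rw [integral_rpow (Or.inl (by norm_num)), Real.one_rpow]
    have : (0 : ℝ) ≤ s ^ (-((0 : ℕ) + 1 / 2 : ℝ) + 1) := Real.rpow_nonneg hs0.le _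
    rw [div_le_iff₀ (by norm_num)]
    norm_num at this ⊢
    linarith
  have hlim : coneMean K y f 0 ≤ C * (1 + max R 0 * 2) * 1 * D.sob (d / 2 + 1) f := by
    have ht : Filter.Tendsto (coneMean K y f) (nhdsWithin 0 (Set.Ioi 0))
        (nhds (coneMean K y f 0)) :=
      (continuous_coneMean hK y f).continuousAt.tendsto.mono_left nhdsWithin_le_nhds
    refine le_of_tendsto ht ?_
    filter_upwards [Ioc_mem_nhdsGT (zero_lt_one (α := ℝ))] with s hs
    exact hle s hs.1 hs.2
  have h0 : coneMean K y f 0 = volume.real K * |(f : _ → ℝ) y| := by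
    simp [coneMean]
  rw [h0, mul_one] at hlim
  rw [mul_assoc, inv_mul_eq_div, le_div_iff₀ hV]
  linarith

/-- The Sobolev inequality on a smooth domain. -/
theorem abs_le_sob : ∃ C, 0 ≤ C ∧ ∀ y ∈ closure D.carrier, ∀ f : SmoothFun (Fin d → ℝ),
    |(f : _ → ℝ) y| ≤ C * D.sob (d / 2 + 1) f := by
  have key : ∃ C, 0 ≤ C ∧ ∀ y ∈ closure D.carrier, y ∈ closure D.carrier →
      ∀ f : SmoothFun (Fin d → ℝ), |(f : _ → ℝ) y| ≤ C * D.sob (d / 2 + 1) f := by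
    refine D.isCompact_closure.induction_on
      (p := fun S => ∃ C, 0 ≤ C ∧ ∀ y ∈ S, y ∈ closure D.carrier →
        ∀ f : SmoothFun (Fin d → ℝ), |(f : _ → ℝ) y| ≤ C * D.sob (d / 2 + 1) f) ?_ ?_ ?_ ?_
    · exact ⟨0, le_rfl, fun y hy => absurd hy (Set.notMem_empty y)⟩
    · rintro S T hST ⟨C, hC0, hC⟩
      exact ⟨C, hC0, fun y hy => hC y (hST hy)⟩
    · rintro S T ⟨C, hC0, hC⟩ ⟨C', hC0', hC'⟩
      refine ⟨C + C', add_nonneg hC0 hC0', fun y hy hyc f => ?_⟩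
      have n := D.sob_nonneg (d / 2 + 1) f
      rcases hy with hy | hy
      · refine (hC y hy hyc f).trans (mul_le_mul_of_nonneg_right ?_ n)
        linarith
      · refine (hC' y hy hyc f).trans (mul_le_mul_of_nonneg_right ?_ n)
        linarith
    · intro y₀ hy₀
      obtain ⟨e₀, r, hr, hcone⟩ : ∃ (e₀ : Fin d → ℝ) (r : ℝ), 0 < r ∧
          ∀ᶠ y in nhds y₀, y ∈ closure D.carrier → D.HasCone (Metric.closedBall e₀ r) y := by
        rw [closure_eq_self_union_frontier] at hy₀
        rcases hy₀ with h | h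
        · obtain ⟨e₀, r, hr, h⟩ := D.exists_cone_of_carrier h
          exact ⟨e₀, r, hr, h.mono fun y hy _ => hy⟩
        · exact D.exists_cone_of_frontier h
      have hK := isCompact_closedBall e₀ r
      obtain ⟨C, hC0, hC⟩ := D.abs_le_sob_of_cone hK (ENNReal.toReal_pos
        (Metric.measure_closedBall_pos volume e₀ hr).ne' hK.measure_lt_top.ne)
      exact ⟨_, mem_nhdsWithin_of_mem_nhds hcone, C, hC0, fun y hy hyc => hC y (hy hyc)⟩
  obtain ⟨C, hC0, hC⟩ := key
  exact ⟨C, hC0, fun y hy => hC y hy hy⟩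

end SmoothDomain

section IteratedSum

variable {α γ : Type*}

theorem opIter_semiconj {δ : Type*} {F : α → γ → γ} {G : α → δ → δ} {c : γ → δ}
    (h : ∀ a u, G a (c u) = c (F a u)) (L : List α) (u : γ) :
    opIter G L (c u) = c (opIter F L u) := by
  induction L with
  | nil => rfl
  | cons a L ih => exact (congrArg (G a) ih).trans (h a _)

theorem opIter_concat (F : α → γ → γ) (L : List α) (a : α) (u : γ) :
    opIter F (L.concat a) u = opIter F L (F a u) := by
  induction L with
  | nil => rfl
  | cons b L ih => exact congrArg (F b) ih

variable [Fintype α] (F : α → γ → γ) (N : γ → ℝ)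

/-- The sum of a functional over all iterated derivatives of order less than `k`. -/
def iterSum (k : ℕ) (u : γ) : ℝ :=
  ∑ n ∈ Finset.range k, ∑ σ : Fin n → α, N (opIter F (List.ofFn σ) u)

theorem iterSum_succ (k : ℕ) (u : γ) :
    iterSum F N (k + 1) u = N u + ∑ a, iterSum F N k (F a u) := by
  have h : ∀ n, ∑ σ : Fin (n + 1) → α, N (opIter F (List.ofFn σ) u) =
      ∑ a, ∑ σ : Fin n → α, N (opIter F (List.ofFn σ) (F a u)) := by
    intro n
    rw [← Fintype.sum_prod_type']
    refine (Fintype.sum_equiv (Fin.snocEquiv fun _ : Fin (n + 1) => α) _ _ ?_).symm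
    rintro ⟨a, σ⟩
    rw [List.ofFn_succ', opIter_concat]
    simp [Fin.snocEquiv]
  simp only [iterSum]
  rw [Finset.sum_range_succ', Finset.sum_comm, add_comm]
  congr 1
  · simp [opIter]
  · exact Finset.sum_congr rfl fun n _ => h n

variable {N}

theorem iterSum_nonneg (hN : ∀ u, 0 ≤ N u) (k : ℕ) (u : γ) : 0 ≤ iterSum F N k u :=
  Finset.sum_nonneg fun _ _ => Finset.sum_nonneg fun _ _ => hN _

theorem iterSum_mono (hN : ∀ u, 0 ≤ N u) {k l : ℕ} (h : k ≤ l) (u : γ) :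
    iterSum F N k u ≤ iterSum F N l u :=
  Finset.sum_le_sum_of_subset_of_nonneg (Finset.range_mono h)
    fun _ _ _ => Finset.sum_nonneg fun _ _ => hN _

theorem le_iterSum (hN : ∀ u, 0 ≤ N u) (k : ℕ) (u : γ) : N u ≤ iterSum F N (k + 1) u := by
  rw [iterSum_succ]
  exact le_add_of_nonneg_right (Finset.sum_nonneg fun _ _ => iterSum_nonneg F hN _ _)

theorem iterSum_apply_le (hN : ∀ u, 0 ≤ N u) (k : ℕ) (a : α) (u : γ) :
    iterSum F N k (F a u) ≤ iterSum F N (k + 1) u := by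
  rw [iterSum_succ]
  have := Finset.single_le_sum (f := fun a => iterSum F N k (F a u))
    (fun _ _ => iterSum_nonneg F hN _ _) (Finset.mem_univ a)
  linarith [hN u]

end IteratedSum

namespace SmoothFun

variable {d : ℕ}

/-- Smooth functions on the waveguide. -/
abbrev Wave (d : ℕ) : Type := SmoothFun ((Fin 4 → ℝ) × (Fin d → ℝ))

/-- A smooth function of a pair, as a function of two variables. -/
def uncurried (W : Wave d) : (Fin 4 → ℝ) → (Fin d → ℝ) → ℝ := fun z y => (W : _ → ℝ) (z, y)

/-- The restriction of a smooth function to a fixed space-time point. -/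
def slice (z : Fin 4 → ℝ) : Wave d →ₗ[ℝ] SmoothFun (Fin d → ℝ) where
  toFun W := ⟨fun y => (W : (Fin 4 → ℝ) × (Fin d → ℝ) → ℝ) (z, y),
    W.contDiff.comp (contDiff_const.prodMk contDiff_id)⟩
  map_add' _ _ := rfl
  map_smul' _ _ := rfl

/-- The derivatives in the space-time directions. -/
def dtx (i : Fin 4) : Derivation ℝ (Wave d) (Wave d) := dir (Pi.single i 1, 0)

/-- The derivatives in the directions of the cross section. -/
def dy (j : Fin d) : Derivation ℝ (Wave d) (Wave d) := dir (0, Pi.single j 1)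

/-- The derivatives in all directions. -/
def dmix : Fin 4 ⊕ Fin d → Derivation ℝ (Wave d) (Wave d)
  | Sum.inl i => dtx i
  | Sum.inr j => dy j

/-- The d'Alembertian on smooth functions. -/
def box (W : Wave d) : Wave d :=
  dtx 0 (dtx 0 W) - dtx 1 (dtx 1 W) - dtx 2 (dtx 2 W) - dtx 3 (dtx 3 W) - ∑ j, dy j (dy j W)

theorem pdtx_uncurried (i : Fin 4) (W : Wave d) : pdtx i (uncurried W) = uncurried (dtx i W) := by
  ext z y
  have h : HasFDerivAt (fun z' => (W : _ → ℝ) (z', y))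
      ((fderiv ℝ (W : _ → ℝ) (z, y)).comp (ContinuousLinearMap.inl ℝ _ _)) z :=
    (W.differentiable (z, y)).hasFDerivAt.comp z (hasFDerivAt_prodMk_left z y)
  exact congrArg (fun l => l (Pi.single i 1)) h.fderiv

theorem fderiv_slice (z : Fin 4 → ℝ) (y e : Fin d → ℝ) (W : Wave d) :
    fderiv ℝ (fun y' => (W : _ → ℝ) (z, y')) y e = fderiv ℝ (W : _ → ℝ) (z, y) (0, e) := by
  have h : HasFDerivAt (fun y' => (W : _ → ℝ) (z, y'))
      ((fderiv ℝ (W : _ → ℝ) (z, y)).comp (ContinuousLinearMap.inr ℝ _ _)) y :=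
    (W.differentiable (z, y)).hasFDerivAt.comp y (hasFDerivAt_prodMk_right z y)
  exact congrArg (fun l => l e) h.fderiv

theorem pdy_uncurried (j : Fin d) (W : Wave d) : pdy j (uncurried W) = uncurried (dy j W) := by
  ext z y
  exact fderiv_slice z y _ W

theorem pder_slice (j : Fin d) (z : Fin 4 → ℝ) (W : Wave d) :
    pder j (slice z W) = slice z (dy j W) := by
  ext y
  exact fderiv_slice z y _ W

theorem pdmix_uncurried (a : Fin 4 ⊕ Fin d) (W : Wave d) :
    pdmix a (uncurried W) = uncurried (dmix a W) :=
  match a with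
  | Sum.inl i => pdtx_uncurried i W
  | Sum.inr j => pdy_uncurried j W

theorem wBox_uncurried (W : Wave d) : wBox (uncurried W) = uncurried (box W) := by
  ext z y
  simp [wBox, box, pdtx_uncurried, pdy_uncurried, uncurried]

theorem dtx_comm_box (i : Fin 4) (W : Wave d) : box (dtx i W) = dtx i (box W) := by
  have h1 : ∀ l : Fin 4, dtx l (dtx l (dtx i W)) = dtx i (dtx l (dtx l W)) := fun l => by
    simp only [dtx]
    rw [dir_comm _ _ W, dir_comm]
  have h2 : ∀ j : Fin d, dy j (dy j (dtx i W)) = dtx i (dy j (dy j W)) := fun j => by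
    simp only [dtx, dy]
    rw [dir_comm _ _ W, dir_comm]
  simp only [box, h1, h2, map_sub, map_sum]

theorem lap_slice (z : Fin 4 → ℝ) (W : Wave d) :
    lap (slice z W) = slice z (dtx 0 (dtx 0 W)) - slice z (dtx 1 (dtx 1 W)) -
      slice z (dtx 2 (dtx 2 W)) - slice z (dtx 3 (dtx 3 W)) - slice z (box W) := by
  simp only [lap, pder_slice, box, map_sub, map_sum]
  abel

end SmoothFun

namespace SmoothDomain

open SmoothFun

variable {d : ℕ} (D : SmoothDomain d)

theorem L2y_uncurried (W : Wave d) (z : Fin 4 → ℝ) :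
    L2y D (uncurried W) z = D.nrm (slice z W) := (D.nrm_eq_sqrt (slice z W)).symm

theorem vanishOn_slice_dtx {W : Wave d} (h : ∀ z, D.VanishOn (slice z W)) (i : Fin 4)
    (z : Fin 4 → ℝ) : D.VanishOn (slice z (dtx i W)) := by
  intro y hy
  have h0 : (fun z' => uncurried W z' y) = fun _ => 0 := funext fun z' => h z' y hy
  change uncurried (dtx i W) z y = 0
  rw [← pdtx_uncurried, pdtx, h0]
  simp

/-- The gradient of the defining function, extended to the waveguide. -/
def nuWave (j : Fin d) : Wave d :=
  ⟨fun p => (D.nu j : (Fin d → ℝ) → ℝ) p.2, (D.nu j).contDiff.comp contDiff_snd⟩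

theorem dtx_nuWave (i : Fin 4) (j : Fin d) : dtx i (D.nuWave j) = 0 := by
  ext ⟨z, y⟩
  change uncurried (dtx i (D.nuWave j)) z y = 0
  rw [← pdtx_uncurried]
  simp [pdtx, uncurried, nuWave]

/-- The normal derivative, as an operator on the waveguide. -/
def normalWave (W : Wave d) : Wave d := ∑ j, D.nuWave j * dy j W

theorem vf_nu_slice (z : Fin 4 → ℝ) (W : Wave d) :
    vf D.nu (slice z W) = slice z (D.normalWave W) := by
  simp only [vf, pder_slice, normalWave, map_sum]
  rfl

theorem dtx_normalWave (i : Fin 4) (W : Wave d) :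
    D.normalWave (dtx i W) = dtx i (D.normalWave W) := by
  simp only [normalWave, map_sum, Derivation.leibniz, D.dtx_nuWave, smul_eq_mul, mul_zero,
    add_zero]
  exact Finset.sum_congr rfl fun j _ => by simp only [dtx, dy]; rw [dir_comm]

/-- The Dirichlet or the Neumann condition at all space-time points. -/
def WaveBC (W : Wave d) : Prop :=
  (∀ z, D.VanishOn (slice z W)) ∨ ∀ z, D.VanishOn (slice z (D.normalWave W))

variable {D} in
theorem WaveBC.dtx {W : Wave d} (h : D.WaveBC W) (i : Fin 4) : D.WaveBC (dtx i W) := by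
  refine h.imp (fun h => D.vanishOn_slice_dtx h i) fun h => ?_
  rw [D.dtx_normalWave]
  exact D.vanishOn_slice_dtx h i

variable {D} in
theorem WaveBC.bc {W : Wave d} (h : D.WaveBC W) (z : Fin 4 → ℝ) : D.BC (slice z W) :=
  h.imp (fun h => h z) fun h => by
    rw [D.vf_nu_slice]
    exact h z

/-- The sum of the norms of the space-time derivatives of order less than `k`. -/
def sumTx (z : Fin 4 → ℝ) : ℕ → Wave d → ℝ :=
  iterSum (fun i W => dtx i W) fun W => D.nrm (slice z W)

/-- The sum of the norms of all derivatives of order less than `k`. -/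
def sumMix (z : Fin 4 → ℝ) : ℕ → Wave d → ℝ :=
  iterSum (fun a W => dmix a W) fun W => D.nrm (slice z W)

theorem sob_slice_le_sumMix (z : Fin 4 → ℝ) (k : ℕ) (W : Wave d) :
    D.sob k (slice z W) ≤ D.sumMix z (k + 1) W := by
  have hN : ∀ W : Wave d, 0 ≤ D.nrm (slice z W) := fun W => D.nrm_nonneg _
  induction k generalizing W with
  | zero => exact le_iterSum _ hN 0 W
  | succ k ih =>
    rw [sumMix, iterSum_succ, sob_succ, Fintype.sum_sum_type]
    have h1 : ∑ j, D.sob k (pder j (slice z W)) ≤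
        ∑ j, D.sumMix z (k + 1) (dmix (Sum.inr j) W) :=
      Finset.sum_le_sum fun j _ => by
        rw [pder_slice]
        exact ih _
    have h2 : 0 ≤ ∑ i : Fin 4, D.sumMix z (k + 1) (dmix (Sum.inl i) W) :=
      Finset.sum_nonneg fun i _ => iterSum_nonneg _ hN _ _
    simp only [sumMix] at h1 h2
    linarith

theorem sob_lap_slice_le (z : Fin 4 → ℝ) (k : ℕ) (W : Wave d) :
    D.sob k (lap (slice z W)) ≤
      ∑ i, D.sob k (slice z (dtx i (dtx i W))) + D.sumMix z (k + 1) (box W) := by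
  rw [lap_slice, Fin.sum_univ_four]
  have h1 := D.sob_slice_le_sumMix z k (box W)
  have s1 := D.sob_sub_le k (slice z (dtx 0 (dtx 0 W))) (slice z (dtx 1 (dtx 1 W)))
  have s2 := D.sob_sub_le k (slice z (dtx 0 (dtx 0 W)) - slice z (dtx 1 (dtx 1 W)))
    (slice z (dtx 2 (dtx 2 W)))
  have s3 := D.sob_sub_le k (slice z (dtx 0 (dtx 0 W)) - slice z (dtx 1 (dtx 1 W)) -
    slice z (dtx 2 (dtx 2 W))) (slice z (dtx 3 (dtx 3 W)))
  refine (D.sob_sub_le k _ _).trans ?_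
  linarith

/-- Control of the Sobolev norms of the slices by space-time derivatives and the d'Alembertian. -/
theorem sob_slice_le (k : ℕ) : ∃ C, 0 ≤ C ∧ ∀ W : Wave d, D.WaveBC W → ∀ z,
    D.sob k (slice z W) ≤ C * (D.sumTx z (k + 2) W + D.sumMix z k (box W)) := by
  have hN : ∀ (z) (W : Wave d), 0 ≤ D.nrm (slice z W) := fun z W => D.nrm_nonneg _
  have hT : ∀ z k W, 0 ≤ D.sumTx z k W := fun z k W => iterSum_nonneg _ (hN z) _ _
  have hM : ∀ z k W, 0 ≤ D.sumMix z k W := fun z k W => iterSum_nonneg _ (hN z) _ _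
  have hT0 : ∀ z k W, D.nrm (slice z W) ≤ D.sumTx z (k + 1) W := fun z k W =>
    le_iterSum _ (hN z) k W
  have hTd : ∀ z k i W, D.sumTx z k (dtx i (dtx i W)) ≤ D.sumTx z (k + 2) W := fun z k i W =>
    (iterSum_apply_le (fun i W => dtx i W) (hN z) k i (dtx i W)).trans
      (iterSum_apply_le (fun i W => dtx i W) (hN z) (k + 1) i W)
  have hMd : ∀ z k i W, D.sumMix z k (box (dtx i (dtx i W))) ≤ D.sumMix z (k + 2) (box W) := by
    intro z k i W
    rw [dtx_comm_box, dtx_comm_box]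
    exact (iterSum_apply_le (fun a W => dmix a W) (hN z) k (Sum.inl i) (dtx i (box W))).trans
      (iterSum_apply_le (fun a W => dmix a W) (hN z) (k + 1) (Sum.inl i) (box W))
  induction k using Nat.twoStepInduction with
  | zero =>
    refine ⟨1, zero_le_one, fun W _ z => ?_⟩
    have h1 : D.sob 0 (slice z W) ≤ D.sumTx z 2 W := hT0 z 1 W
    have h2 := hM z 0 (box W)
    linarith
  | one =>
    obtain ⟨C, hC0, hC⟩ := D.sob_one_le_lap
    refine ⟨C * 5, by positivity, fun W hW z => (hC _ (hW.bc z)).trans ?_⟩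
    rw [mul_assoc]
    refine mul_le_mul_of_nonneg_left ?_ hC0
    have h1 := D.sob_lap_slice_le z 0 W
    have h2 : ∑ i, D.sob 0 (slice z (dtx i (dtx i W))) ≤ ∑ i : Fin 4, D.sumTx z 3 W :=
      Finset.sum_le_sum fun i _ => (hT0 z 0 _).trans (hTd z 1 i W)
    rw [Finset.sum_const, Finset.card_univ, Fintype.card_fin, nsmul_eq_mul] at h2
    have h3 : D.nrm (slice z W) ≤ D.sumTx z 3 W := hT0 z 2 W
    have h4 := hM z 1 (box W)
    change D.nrm (lap (slice z W)) ≤ _ at h1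
    norm_num at h1 h2 ⊢
    linarith
  | more k ih _ =>
    obtain ⟨C, hC0, hC⟩ := D.sob_add_two_le k
    obtain ⟨B, hB0, hB⟩ := ih
    refine ⟨C * (2 + 4 * B), by positivity, fun W hW z => (hC _ (hW.bc z)).trans ?_⟩
    rw [mul_assoc]
    refine mul_le_mul_of_nonneg_left ?_ hC0
    set Q := D.sumTx z (k + 2 + 2) W + D.sumMix z (k + 2) (box W) with hQ
    have h1 := D.sob_lap_slice_le z k W
    have h2 : ∑ i, D.sob k (slice z (dtx i (dtx i W))) ≤ ∑ i : Fin 4, B * Q :=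
      Finset.sum_le_sum fun i _ => (hB _ ((hW.dtx i).dtx i) z).trans
        (mul_le_mul_of_nonneg_left (add_le_add (hTd z _ i W) (hMd z _ i W)) hB0)
    rw [Finset.sum_const, Finset.card_univ, Fintype.card_fin, nsmul_eq_mul] at h2
    have h3 : D.nrm (slice z W) ≤ D.sumTx z (k + 2 + 2) W := hT0 z _ W
    have h4 : D.sumMix z (k + 1) (box W) ≤ D.sumMix z (k + 2) (box W) :=
      iterSum_mono _ (hN z) (Nat.le_succ _) _
    have h5 := hT z (k + 2 + 2) W
    have h6 := hM z (k + 2) (box W)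
    push_cast at h2
    linarith

theorem sob_opIter_pder_le (m : ℕ) (L : List (Fin d)) (f : SmoothFun (Fin d → ℝ)) :
    D.sob m (opIter (fun i f => pder i f) L f) ≤ D.sob (L.length + m) f := by
  induction L generalizing m with
  | nil => simp [opIter]
  | cons a L ih =>
    refine (D.sob_pder_le m a _).trans ((ih (m + 1)).trans_eq ?_)
    rw [List.length_cons]
    congr 1
    ring

end SmoothDomain

/-- pointwise Sobolev bound on the waveguide: let `Ω ⊂ ℝ^d` be a nonempty
bounded domain with smooth boundary.  For every multi-index `β` (a list of `y`-directions)
there is a constant `C` such that for every `u ∈ C^∞(ℝ₊×ℝ³×Ω̄)` satisfying the Dirichlet or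
Neumann boundary condition and every `(t,x,y)`,
`|∂_y^β u(t,x,y)| ≤ C Σ_{|α|≤|β|+(d+4)/2} ‖∂_{t,x}^α u(t,x,·)‖_{L²(Ω)}
  + C Σ_{|α|≤|β|+d/2} ‖∂_{t,x,y}^α □u(t,x,·)‖_{L²(Ω)}`. -/
theorem stmt16 (d : ℕ) (D : SmoothDomain d) (L : List (Fin d)) :
    ∃ C : ℝ, 0 < C ∧
      ∀ u : (Fin 4 → ℝ) → (Fin d → ℝ) → ℝ, SmoothC u →
        (DirichletBC D u ∨ NeumannBC D u) →
        ∀ z : Fin 4 → ℝ, 0 ≤ z 0 → ∀ y ∈ closure D.carrier,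
          |opIter pdy L u z y| ≤
            C * (∑ n ∈ Finset.range (L.length + (d + 4) / 2 + 1), ∑ σ : Fin n → Fin 4,
                L2y D (opIter pdtx (List.ofFn σ) u) z) +
            C * (∑ n ∈ Finset.range (L.length + d / 2 + 1), ∑ σ : Fin n → (Fin 4 ⊕ Fin d),
                L2y D (opIter pdmix (List.ofFn σ) (wBox u)) z) := by
  obtain ⟨A, hA0, hA⟩ := D.abs_le_sob
  obtain ⟨B, hB0, hB⟩ := D.sob_slice_le (L.length + (d / 2 + 1))
  refine ⟨A * B + 1, by positivity, fun u hu hbc z _ y hy => ?_⟩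
  obtain ⟨W, rfl⟩ : ∃ W : SmoothFun.Wave d, u = W.uncurried :=
    ⟨⟨fun p => u p.1 p.2, hu⟩, rfl⟩
  have hW : D.WaveBC W := by
    refine hbc.imp (fun h z y hy => h z y hy) fun h z y hy => ?_
    rw [← D.vf_nu_slice]
    refine Eq.trans ?_ (h z y hy)
    simp only [SmoothFun.vf, SmoothDomain.nder, AddSubmonoidClass.coe_finsetSum, Finset.sum_apply]
    rfl
  have hT : iterSum (fun i W => SmoothFun.dtx i W) (fun W => D.nrm (SmoothFun.slice z W))
      (L.length + (d + 4) / 2 + 1) W = ∑ n ∈ Finset.range (L.length + (d + 4) / 2 + 1),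
        ∑ σ : Fin n → Fin 4, L2y D (opIter pdtx (List.ofFn σ) W.uncurried) z := by
    simp only [iterSum, opIter_semiconj SmoothFun.pdtx_uncurried, D.L2y_uncurried]
  have hM : iterSum (fun a W => SmoothFun.dmix a W) (fun W => D.nrm (SmoothFun.slice z W))
      (L.length + d / 2 + 1) W.box = ∑ n ∈ Finset.range (L.length + d / 2 + 1),
        ∑ σ : Fin n → Fin 4 ⊕ Fin d,
          L2y D (opIter pdmix (List.ofFn σ) (wBox W.uncurried)) z := by
    simp only [iterSum, SmoothFun.wBox_uncurried, opIter_semiconj SmoothFun.pdmix_uncurried,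
      D.L2y_uncurried]
  have hN : ∀ W : SmoothFun.Wave d, 0 ≤ D.nrm (SmoothFun.slice z W) := fun W => D.nrm_nonneg _
  have hslice : opIter pdy L W.uncurried z y =
      (opIter (fun i (f : SmoothFun (Fin d → ℝ)) => SmoothFun.pder i f) L
        (SmoothFun.slice z W) : SmoothFun (Fin d → ℝ)).1 y := by
    rw [opIter_semiconj SmoothFun.pdy_uncurried,
      opIter_semiconj (F := fun i f => SmoothFun.dy i f) (c := SmoothFun.slice z)
        fun a u => SmoothFun.pder_slice a z u]
    rfl
  have hk : L.length + (d / 2 + 1) + 2 = L.length + (d + 4) / 2 + 1 := by omega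
  have key := hB W hW z
  rw [SmoothDomain.sumTx, SmoothDomain.sumMix, hk] at key
  rw [hslice, ← hT, ← hM, ← mul_add]
  calc _ ≤ A * D.sob (d / 2 + 1) _ := hA y hy _
    _ ≤ A * (B * _) := mul_le_mul_of_nonneg_left ((D.sob_opIter_pder_le _ _ _).trans key) hA0
    _ = A * B * _ := (mul_assoc _ _ _).symm
    _ ≤ _ := mul_le_mul_of_nonneg_right (by linarith)
      (add_nonneg (iterSum_nonneg _ hN _ _) (iterSum_nonneg _ hN _ _))
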